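/- arXiv:1506.04726 — 2 statements merged into one kernel-verified Lean document; each statement's English description precedes it below -/
import Mathlib

section
/- Let n ≥ 1 and 1 ≤ s ≤ n + 2, and let p_1, …, p_s ∈ K^n be points such that every subset of at most n + 1 of them is affinely independent. Then for all integers d ≥ 0 and m_1, …, m_s ≥ 0 the following are equivalent: (1) there exist a real constant c > 0 and infinitely many ν ∈ ℕ such that dim_K L_{n,ν·d}(ν·m_1, …, ν·m_s) ≥ c·ν^n (i.e. the divisor D = dH − Σ m_i E_i on the blow-up of ℙ^n at p_1,…,p_s is big); (2) d > 0, m_i < d for every i, and Σ_{i∈I} m_i < n·d for every subset I ⊆ {1,…,s} with |I| = n + 1 or |I| = n + 2. (Theorem on the big cone of the blow-up of ℙ^n at s ≤ n+2 points in general position.) -/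
/-- Iterated partial derivative `∂^α` as a linear endomorphism of the polynomial ring. -/
noncomputable def pd {K : Type*} [CommSemiring K] {n : ℕ} (α : Fin n → ℕ) :
    MvPolynomial (Fin n) K →ₗ[K] MvPolynomial (Fin n) K :=
  (List.finRange n).foldl
    (fun L i => ((MvPolynomial.pderiv i).toLinearMap ^ α i) ∘ₗ L) LinearMap.id

/-- The linear system `L_{n,d}(m₁,…,m_s)`: polynomials of total degree `≤ d` with
multiplicity at least `mᵢ` at `pᵢ`, as a subspace of the polynomial ring. -/
noncomputable def Lsys (K : Type*) [Field K] (n s d : ℕ) (m : Fin s → ℕ)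
    (p : Fin s → Fin n → K) : Submodule K (MvPolynomial (Fin n) K) :=
  MvPolynomial.restrictTotalDegree (Fin n) K d ⊓
    ⨅ (i : Fin s), ⨅ (α : Fin n → ℕ), ⨅ (_ : (∑ j, α j) < m i),
      LinearMap.ker ((MvPolynomial.aeval (p i)).toLinearMap ∘ₗ pd α)


open MvPolynomial in
/-- translation of the origin to `p` -/
noncomputable def shf {K : Type*} [Field K] {n : ℕ} (p : Fin n → K) :
    MvPolynomial (Fin n) K →ₐ[K] MvPolynomial (Fin n) K :=
  aeval (fun i => X i + C (p i))

/-- multiplicity at least `M`, via Taylor coefficients -/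
def HasMul {K : Type*} [Field K] {n : ℕ} (p : Fin n → K) (M : ℕ)
    (F : MvPolynomial (Fin n) K) : Prop :=
  ∀ β : Fin n →₀ ℕ, β.degree < M → MvPolynomial.coeff β (shf p F) = 0

section A
open MvPolynomial
variable {K : Type*} [Field K] {n : ℕ}

lemma shf_shf_neg (p : Fin n → K) (F : MvPolynomial (Fin n) K) :
    shf (-p) (shf p F) = F := by
  have : (shf (-p)).comp (shf p) = AlgHom.id K (MvPolynomial (Fin n) K) := by
    apply MvPolynomial.algHom_ext
    intro i
    simp [shf]
  exact DFunLike.congr_fun this F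

lemma shf_injective (p : Fin n → K) : Function.Injective (shf p) := by
  intro a b h
  rw [← shf_shf_neg p a, h, shf_shf_neg]

lemma shf_pderiv (p : Fin n → K) (i : Fin n) (F : MvPolynomial (Fin n) K) :
    shf p (pderiv i F) = pderiv i (shf p F) := by
  classical
  induction F using MvPolynomial.induction_on with
  | C a => simp [shf]
  | add p q hp hq => simp [hp, hq]
  | mul_X q j h =>
    simp only [Derivation.leibniz, pderiv_X, smul_eq_mul, map_add, map_mul, h]
    simp [shf, Pi.single_apply, apply_ite]

lemma aeval_eq_coeff (p : Fin n → K) (F : MvPolynomial (Fin n) K) :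
    aeval p F = coeff 0 (shf p F) := by
  induction F using MvPolynomial.induction_on with
  | C a => simp [shf]
  | add p q hp hq => rw [map_add, map_add, coeff_add, hp, hq]
  | mul_X q j h =>
    rw [← constantCoeff_eq] at h ⊢
    rw [map_mul, map_mul, map_mul, h]
    simp [shf]

lemma pderiv_pow_coeff (i : Fin n) (k : ℕ) (γ : Fin n →₀ ℕ) : ∃ N : ℕ, 0 < N ∧
    ∀ G : MvPolynomial (Fin n) K, coeff γ (((pderiv i).toLinearMap ^ k) G) =
      N * coeff (γ + Finsupp.single i k) G := by
  induction k generalizing γ with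
  | zero => exact ⟨1, one_pos, fun G => by simp⟩
  | succ k ih =>
    obtain ⟨N, hN, h⟩ := ih (γ + Finsupp.single i 1)
    refine ⟨N * (γ i + 1), by positivity, fun G => ?_⟩
    rw [pow_succ', Module.End.mul_apply]
    change coeff γ (pderiv i (((pderiv i).toLinearMap ^ k) G)) = _
    rw [coeff_pderiv, h, add_assoc, ← Finsupp.single_add, add_comm 1 k]
    push_cast; ring

lemma foldl_coeff (α : Fin n → ℕ) (l : List (Fin n)) (γ : Fin n →₀ ℕ) : ∃ N : ℕ, 0 < N ∧
    ∀ (L : MvPolynomial (Fin n) K →ₗ[K] MvPolynomial (Fin n) K) (G : MvPolynomial (Fin n) K),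
      coeff γ (l.foldl (fun L i => ((pderiv i).toLinearMap ^ α i) ∘ₗ L) L G) =
      N * coeff (γ + (l.map fun i => Finsupp.single i (α i)).sum) (L G) := by
  induction l generalizing γ with
  | nil => exact ⟨1, one_pos, fun L G => by simp⟩
  | cons i l ih =>
    obtain ⟨N, hN, h⟩ := ih γ
    obtain ⟨N', hN', h'⟩ := pderiv_pow_coeff (K := K) i (α i)
      (γ + (l.map fun i => Finsupp.single i (α i)).sum)
    refine ⟨N * N', by positivity, fun L G => ?_⟩
    rw [List.foldl_cons, h, LinearMap.comp_apply, h', List.map_cons, List.sum_cons, add_assoc,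
      add_comm (List.sum _)]
    push_cast; ring

lemma pd_coeff (α : Fin n → ℕ) : ∃ N : ℕ, 0 < N ∧ ∀ G : MvPolynomial (Fin n) K,
    coeff 0 (pd α G) = N * coeff (Finsupp.equivFunOnFinite.symm α) G := by
  obtain ⟨N, hN, h⟩ := foldl_coeff (K := K) α (List.finRange n) 0
  refine ⟨N, hN, fun G => ?_⟩
  rw [pd, h, LinearMap.id_apply, zero_add]
  congr 3
  rw [← List.ofFn_eq_map, List.sum_ofFn]
  ext j
  simp [Finsupp.finsetSum_apply, Finsupp.single_apply]

lemma shf_pd_foldl (p : Fin n → K) (α : Fin n → ℕ) (l : List (Fin n))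
    (L : MvPolynomial (Fin n) K →ₗ[K] MvPolynomial (Fin n) K)
    (hL : ∀ F, shf p (L F) = L (shf p F)) (F : MvPolynomial (Fin n) K) :
    shf p (l.foldl (fun L i => ((pderiv i).toLinearMap ^ α i) ∘ₗ L) L F) =
      l.foldl (fun L i => ((pderiv i).toLinearMap ^ α i) ∘ₗ L) L (shf p F) := by
  induction l generalizing L with
  | nil => simpa using hL F
  | cons i l ih =>
    rw [List.foldl_cons]
    apply ih
    intro F
    have : ∀ k G, shf p (((pderiv i).toLinearMap ^ k) G) =
        ((pderiv i).toLinearMap ^ k) (shf p G) := by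
      intro k
      induction k with
      | zero => intro G; simp
      | succ k ihk =>
        intro G
        rw [pow_succ, Module.End.mul_apply, Module.End.mul_apply, ihk]
        simp [shf_pderiv]
    rw [LinearMap.comp_apply, LinearMap.comp_apply, this, hL]

lemma mul_iff [CharZero K] (p : Fin n → K) (M : ℕ) (F : MvPolynomial (Fin n) K) :
    (∀ α : Fin n → ℕ, (∑ j, α j) < M → aeval p (pd α F) = 0) ↔ HasMul p M F := by
  have key : ∀ α : Fin n → ℕ, aeval p (pd α F) = 0 ↔
      coeff (Finsupp.equivFunOnFinite.symm α) (shf p F) = 0 := by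
    intro α
    obtain ⟨N, hN, h⟩ := pd_coeff (K := K) α
    rw [aeval_eq_coeff, pd, shf_pd_foldl _ _ _ _ (by simp), ← pd, h]
    simp [hN.ne']
  constructor
  · intro h β hβ
    have := (key β).1 (h β (by rwa [← Finsupp.degree_eq_sum]))
    simpa using this
  · intro h α hα
    rw [key]
    apply h
    rw [Finsupp.degree_eq_sum]
    simpa using hα

lemma mem_Lsys [CharZero K] (s d : ℕ) (m : Fin s → ℕ) (p : Fin s → Fin n → K)
    (F : MvPolynomial (Fin n) K) :
    F ∈ Lsys K n s d m p ↔ F.totalDegree ≤ d ∧ ∀ i, HasMul (p i) (m i) F := by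
  simp only [Lsys, Submodule.mem_inf, mem_restrictTotalDegree, Submodule.mem_iInf, ← mul_iff]
  rfl

lemma HasMul.mul {p : Fin n → K} {M M' : ℕ} {F G : MvPolynomial (Fin n) K}
    (hF : HasMul p M F) (hG : HasMul p M' G) : HasMul p (M + M') (F * G) := by
  classical
  intro β hβ
  rw [map_mul, coeff_mul]
  apply Finset.sum_eq_zero
  rintro ⟨a, b⟩ h
  rw [Finset.HasAntidiagonal.mem_antidiagonal] at h
  subst h
  simp only [map_add] at hβ ⊢
  by_cases h1 : a.degree < M
  · rw [hF a h1, zero_mul]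
  · rw [hG b (by omega), mul_zero]

lemma HasMul.zero (p : Fin n → K) (F : MvPolynomial (Fin n) K) : HasMul p 0 F :=
  fun _ h => absurd h (by omega)

lemma HasMul.pow {p : Fin n → K} {M : ℕ} {F : MvPolynomial (Fin n) K}
    (hF : HasMul p M F) (t : ℕ) : HasMul p (t * M) (F ^ t) := by
  induction t with
  | zero => simpa using HasMul.zero p _
  | succ t ih => rw [pow_succ, Nat.succ_mul]; exact ih.mul hF

lemma HasMul.mono {p : Fin n → K} {M M' : ℕ} {F : MvPolynomial (Fin n) K}
    (hF : HasMul p M F) (h : M' ≤ M) : HasMul p M' F :=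
  fun β hβ => hF β (by omega)

lemma HasMul.one {p : Fin n → K} {F : MvPolynomial (Fin n) K}
    (hF : aeval p F = 0) : HasMul p 1 F := by
  intro β hβ
  have : β = 0 := by
    rw [← Finsupp.degree_eq_zero_iff]; omega
  rw [this, ← aeval_eq_coeff, hF]

lemma shf_totalDegree_le (p : Fin n → K) (F : MvPolynomial (Fin n) K) :
    (shf p F).totalDegree ≤ F.totalDegree := by
  rw [shf, aeval_def, eval₂_eq']
  apply totalDegree_finsetSum_le
  intro β hβ
  refine (totalDegree_mul _ _).trans ?_
  rw [algebraMap_eq, totalDegree_C, zero_add]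
  refine (totalDegree_finsetProd _ _).trans ?_
  refine le_trans ?_ (le_totalDegree hβ)
  rw [Finsupp.sum_fintype _ _ (by simp)]
  apply Finset.sum_le_sum
  intro i _
  refine (totalDegree_pow _ _).trans ?_
  have : (X i + C (p i) : MvPolynomial (Fin n) K).totalDegree ≤ 1 :=
    (totalDegree_add _ _).trans (by simp)
  nlinarith

end A

section B
open MvPolynomial
variable {K : Type*} [Field K] {n : ℕ}

/-- homogenized evaluation -/
noncomputable def hev {A : Type*} [CommRing A] [Algebra K A] (D : ℕ) (x0 : A) (x : Fin n → A)
    (F : MvPolynomial (Fin n) K) : A :=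
  ∑ β ∈ F.support, algebraMap K A (coeff β F) * x0 ^ (D - β.degree) * ∏ i, x i ^ β i

lemma map_hev {A B : Type*} [CommRing A] [Algebra K A] [CommRing B] [Algebra K B]
    (f : A →ₐ[K] B) (D : ℕ) (x0 : A) (x : Fin n → A) (F : MvPolynomial (Fin n) K) :
    f (hev D x0 x F) = hev D (f x0) (fun i => f (x i)) F := by
  simp [hev, map_sum, map_mul, map_prod, map_pow]

lemma degree_le_of_mem {D : ℕ} {F : MvPolynomial (Fin n) K} (hF : F.totalDegree ≤ D)
    {β : Fin n →₀ ℕ} (hβ : β ∈ F.support) : β.degree ≤ D :=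
  (le_totalDegree hβ).trans hF

lemma hev_field {E : Type*} [Field E] [Algebra K E] (D : ℕ) (x0 : E) (hx : x0 ≠ 0)
    (x : Fin n → E) (F : MvPolynomial (Fin n) K) (hF : F.totalDegree ≤ D) :
    hev D x0 x F = x0 ^ D * aeval (fun i => x i / x0) F := by
  rw [aeval_def, eval₂_eq', hev, Finset.mul_sum]
  apply Finset.sum_congr rfl
  intro β hβ
  have h := degree_le_of_mem hF hβ
  have h2 : ∏ i, (x i / x0) ^ β i = (∏ i, x i ^ β i) / x0 ^ β.degree := by
    rw [Finsupp.degree_eq_sum, ← Finset.prod_pow_eq_pow_sum, ← Finset.prod_div_distrib]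
    simp [div_pow]
  rw [h2]
  have h3 : x0 ^ D = x0 ^ (D - β.degree) * x0 ^ β.degree := by
    rw [← pow_add]; congr 1; omega
  rw [h3]
  field_simp

lemma aeval_shf {E : Type*} [CommRing E] [Algebra K E] (p : Fin n → K) (y : Fin n → E)
    (F : MvPolynomial (Fin n) K) :
    aeval (fun i => y i - algebraMap K E (p i)) (shf p F) = aeval y F := by
  have : (aeval (fun i => y i - algebraMap K E (p i))).comp (shf p) = aeval y := by
    apply MvPolynomial.algHom_ext
    intro i
    simp [shf]
  exact DFunLike.congr_fun this F

lemma hev_shf (D : ℕ) (x0 : Polynomial K) (hx : x0 ≠ 0)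
    (x : Fin n → Polynomial K) (p : Fin n → K) (F : MvPolynomial (Fin n) K)
    (hF : F.totalDegree ≤ D) :
    hev D x0 x F = hev D x0 (fun i => x i - Polynomial.C (p i) * x0) (shf p F) := by
  let f : Polynomial K →ₐ[K] FractionRing (Polynomial K) :=
    IsScalarTower.toAlgHom K (Polynomial K) (FractionRing (Polynomial K))
  have hf : Function.Injective f := IsFractionRing.injective _ _
  apply hf
  have hx' : f x0 ≠ 0 := by rwa [Ne, map_eq_zero_iff f hf]
  rw [map_hev, map_hev, hev_field _ _ hx' _ _ hF,
    hev_field _ _ hx' _ _ ((shf_totalDegree_le p F).trans hF), ← aeval_shf p]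
  congr 2
  congr 1
  funext i
  have : f (Polynomial.C (p i)) = algebraMap K _ (p i) := f.commutes (p i)
  rw [map_sub, map_mul, this]
  field_simp

lemma pow_dvd_hev (D M : ℕ) (x0 : Polynomial K) (hx : x0 ≠ 0)
    (x : Fin n → Polynomial K) (p : Fin n → K) (F : MvPolynomial (Fin n) K)
    (hF : F.totalDegree ≤ D) (hM : HasMul p M F) (T : Polynomial K)
    (hT : ∀ i, T ∣ x i - Polynomial.C (p i) * x0) : T ^ M ∣ hev D x0 x F := by
  rw [hev_shf D x0 hx x p F hF, hev]
  apply Finset.dvd_sum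
  intro β hβ
  apply Dvd.dvd.mul_left
  have h : M ≤ β.degree := by
    by_contra h
    exact (mem_support_iff.1 hβ) (hM β (by omega))
  refine (pow_dvd_pow T h).trans ?_
  rw [Finsupp.degree_eq_sum, ← Finset.prod_pow_eq_pow_sum]
  exact Finset.prod_dvd_prod_of_dvd _ _ fun i _ => pow_dvd_pow_of_dvd (hT i) _

lemma natDegree_hev (D N : ℕ) (x0 : Polynomial K) (hx0 : x0.natDegree ≤ N)
    (x : Fin n → Polynomial K) (hx : ∀ i, (x i).natDegree ≤ N) (F : MvPolynomial (Fin n) K)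
    (hF : F.totalDegree ≤ D) : (hev D x0 x F).natDegree ≤ N * D := by
  apply Polynomial.natDegree_sum_le_of_forall_le
  intro β hβ
  have h := degree_le_of_mem hF hβ
  have h1 : (∏ i, x i ^ β i).natDegree ≤ N * β.degree := by
    refine (Polynomial.natDegree_prod_le _ _).trans ?_
    rw [Finsupp.degree_eq_sum, Finset.mul_sum]
    apply Finset.sum_le_sum
    intro i _
    refine Polynomial.natDegree_pow_le.trans ?_
    rw [mul_comm]
    exact Nat.mul_le_mul_right _ (hx i)
  have h2 : (x0 ^ (D - β.degree)).natDegree ≤ N * (D - β.degree) := by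
    refine Polynomial.natDegree_pow_le.trans ?_
    rw [mul_comm]
    exact Nat.mul_le_mul_right _ hx0
  have h3 : N * D = N * (D - β.degree) + N * β.degree := by
    rw [← mul_add]; congr 1; omega
  rw [h3]
  refine Polynomial.natDegree_mul_le.trans (add_le_add ?_ h1)
  exact (Polynomial.natDegree_C_mul_le _ _).trans h2

/-- The main vanishing lemma on one curve. -/
lemma curve_vanish (b : Fin (n+1) → Fin n → K) (q : Fin (n+1) → K) (pl : Fin n → K)
    (hq1 : ∑ l, q l = 1) (hpl : ∀ i, pl i = ∑ l, q l * b l i)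
    (M : Fin (n+1) → ℕ) (Ml D : ℕ) (F : MvPolynomial (Fin n) K) (hF : F.totalDegree ≤ D)
    (hM : ∀ l, HasMul (b l) (M l) F) (hMl : HasMul pl Ml F) (hsum : n * D < ∑ l, M l + Ml)
    (c : Fin (n+1) → K) (hc : Function.Injective c) (hc0 : ∀ l, c l ≠ 0) (hc1 : ∀ l, c l + 1 ≠ 0)
    (hcq : ∑ l, c l * q l ≠ 0) :
    hev D (∑ l, c l * q l) (fun i => ∑ l, c l * q l * b l i) F = 0 := by
  classical
  let T : Fin (n+1) → Polynomial K := fun k => 1 - Polynomial.C (c k + 1) * Polynomial.X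
  let Q : Fin (n+1) → Polynomial K := fun l => ∏ k ∈ Finset.univ.erase l, T k
  let x0 : Polynomial K := ∑ l, Polynomial.C (c l * q l) * Q l
  let x : Fin n → Polynomial K := fun i => ∑ l, Polynomial.C (c l * q l * b l i) * Q l
  have hQ0 : ∀ l, (Q l).eval 0 = 1 := by
    intro l; simp [Q, T, Polynomial.eval_prod]
  have hQ1 : ∀ l, c l * (Q l).eval 1 = - ∏ k, (- c k) := by
    intro l
    rw [← Finset.mul_prod_erase _ _ (Finset.mem_univ l)]
    simp [Q, T, Polynomial.eval_prod]
  have hx00 : x0.eval 0 = ∑ l, c l * q l := by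
    simp [x0, Polynomial.eval_finsetSum, hQ0]
  have hxi0 : ∀ i, (x i).eval 0 = ∑ l, c l * q l * b l i := by
    intro i
    simp [x, Polynomial.eval_finsetSum, hQ0]
  have hx0 : x0 ≠ 0 := by
    intro h
    rw [h] at hx00
    simp at hx00
    exact hcq hx00.symm
  have hTdeg : ∀ k, (T k).natDegree = 1 := by
    intro k
    have : T k = Polynomial.C (-(c k + 1)) * Polynomial.X + Polynomial.C 1 := by
      simp only [T, Polynomial.C_neg, Polynomial.C_1]; ring
    rw [this]
    exact Polynomial.natDegree_linear (neg_ne_zero.2 (hc1 k))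
  have hQdeg : ∀ l, (Q l).natDegree ≤ n := by
    intro l
    refine (Polynomial.natDegree_prod_le _ _).trans ?_
    simp [hTdeg]
  have hdeg : (hev D x0 x F).natDegree ≤ n * D := by
    apply natDegree_hev _ _ _ _ _ _ _ hF
    · apply Polynomial.natDegree_sum_le_of_forall_le
      intro l _
      exact (Polynomial.natDegree_C_mul_le _ _).trans (hQdeg l)
    · intro i
      apply Polynomial.natDegree_sum_le_of_forall_le
      intro l _
      exact (Polynomial.natDegree_C_mul_le _ _).trans (hQdeg l)
  have hd1 : ∀ k, T k ^ M k ∣ hev D x0 x F := by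
    intro k
    apply pow_dvd_hev _ _ _ hx0 _ _ _ hF (hM k)
    intro i
    have : x i - Polynomial.C (b k i) * x0 =
        ∑ l, Polynomial.C (c l * q l * (b l i - b k i)) * Q l := by
      simp only [x, x0, Finset.mul_sum, ← Finset.sum_sub_distrib]
      apply Finset.sum_congr rfl
      intro l _
      simp only [map_mul, map_sub]; ring
    rw [this]
    apply Finset.dvd_sum
    intro l _
    by_cases h : l = k
    · simp [h]
    · exact Dvd.dvd.mul_left (Finset.dvd_prod_of_mem _ (by simp [Ne.symm h])) _
  let S : Polynomial K := Polynomial.X - Polynomial.C 1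
  have hd2 : S ^ Ml ∣ hev D x0 x F := by
    apply pow_dvd_hev _ _ _ hx0 _ _ _ hF hMl
    intro i
    rw [Polynomial.dvd_iff_isRoot, Polynomial.IsRoot.def]
    have e1 : x0.eval 1 = - ∏ k, (- c k) := by
      simp only [x0, Polynomial.eval_finsetSum, Polynomial.eval_mul, Polynomial.eval_C]
      calc _ = ∑ l, q l * (c l * (Q l).eval 1) := Finset.sum_congr rfl fun l _ => by ring
        _ = _ := by simp only [hQ1]; rw [← Finset.sum_mul, hq1, one_mul]
    have e2 : (x i).eval 1 = pl i * (- ∏ k, (- c k)) := by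
      simp only [x, Polynomial.eval_finsetSum, Polynomial.eval_mul, Polynomial.eval_C]
      calc _ = ∑ l, q l * b l i * (c l * (Q l).eval 1) := Finset.sum_congr rfl fun l _ => by ring
        _ = _ := by simp only [hQ1]; rw [← Finset.sum_mul, hpl]
    rw [Polynomial.eval_sub, Polynomial.eval_mul, Polynomial.eval_C, e1, e2, sub_self]
  have hcop : Pairwise (Function.onFun IsCoprime fun k => T k ^ M k) := by
    intro k l hkl
    apply IsCoprime.pow
    have hne : c l - c k ≠ 0 := sub_ne_zero.2 fun h => hkl (hc h.symm)
    refine ⟨Polynomial.C ((c l + 1) / (c l - c k)), - Polynomial.C ((c k + 1) / (c l - c k)), ?_⟩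
    have e : (1 : Polynomial K) = Polynomial.C ((c l + 1) / (c l - c k)) -
        Polynomial.C ((c k + 1) / (c l - c k)) := by
      rw [← Polynomial.C_sub, ← Polynomial.C_1]; congr 1; field_simp; ring
    have e2 : Polynomial.C ((c l + 1) / (c l - c k)) * Polynomial.C (c k + 1) =
        Polynomial.C ((c k + 1) / (c l - c k)) * Polynomial.C (c l + 1) := by
      rw [← Polynomial.C_mul, ← Polynomial.C_mul]; congr 1; field_simp
    simp only [T]
    linear_combination (-Polynomial.X) * e2 - e
  have hcop2 : IsCoprime (∏ k, T k ^ M k) (S ^ Ml) := by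
    apply IsCoprime.prod_left
    intro k _
    apply IsCoprime.pow
    refine ⟨Polynomial.C (-(c k)⁻¹), -Polynomial.C ((c k + 1) * (c k)⁻¹), ?_⟩
    have e : (1 : Polynomial K) = Polynomial.C (c k) * Polynomial.C ((c k)⁻¹) := by
      rw [← Polynomial.C_mul, mul_inv_cancel₀ (hc0 k), Polynomial.C_1]
    simp only [T, S, map_neg, map_mul, map_add, Polynomial.C_1]
    linear_combination -e
  have hdvd : (∏ k, T k ^ M k) * S ^ Ml ∣ hev D x0 x F :=
    hcop2.mul_dvd (Fintype.prod_dvd_of_coprime hcop hd1) hd2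
  have hT0 : ∀ k, T k ≠ 0 := fun k h => by
    have := hTdeg k; rw [h] at this; simp at this
  have hPdeg : ((∏ k, T k ^ M k) * S ^ Ml).natDegree = ∑ l, M l + Ml := by
    rw [Polynomial.natDegree_mul (Finset.prod_ne_zero_iff.2 fun k _ => pow_ne_zero _ (hT0 k))
      (pow_ne_zero _ (Polynomial.X_sub_C_ne_zero _)),
      Polynomial.natDegree_prod _ _ (fun k _ => pow_ne_zero _ (hT0 k))]
    simp only [Polynomial.natDegree_pow, hTdeg, S, Polynomial.natDegree_X_sub_C, mul_one]
  have hz : hev D x0 x F = 0 := by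
    apply Polynomial.eq_zero_of_dvd_of_natDegree_lt hdvd
    omega
  have := map_hev (Polynomial.aeval (0 : K)) D x0 x F
  rw [hz, map_zero] at this
  simp only [Polynomial.coe_aeval_eq_eval, hx00, hxi0] at this
  exact this.symm

lemma vanish [CharZero K] (b : Fin (n+1) → Fin n → K) (q : Fin (n+1) → K) (pl : Fin n → K)
    (hspan : ∀ y : Fin n → K, ∃ r : Fin (n+1) → K, ∑ l, r l = 1 ∧ ∀ i, y i = ∑ l, r l * b l i)
    (hq0 : ∀ l, q l ≠ 0)
    (hq1 : ∑ l, q l = 1) (hpl : ∀ i, pl i = ∑ l, q l * b l i)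
    (M : Fin (n+1) → ℕ) (Ml D : ℕ) (F : MvPolynomial (Fin n) K) (hF : F.totalDegree ≤ D)
    (hM : ∀ l, HasMul (b l) (M l) F) (hMl : HasMul pl Ml F) (hsum : n * D < ∑ l, M l + Ml) :
    F = 0 := by
  classical
  let x0 : MvPolynomial (Fin (n+1)) K := ∑ l, X l * C (q l)
  let x : Fin n → MvPolynomial (Fin (n+1)) K := fun i => ∑ l, X l * C (q l) * C (b l i)
  let G := hev D x0 x F
  have hG : ∀ c : Fin (n+1) → K, eval c G =
      hev D (∑ l, c l * q l) (fun i => ∑ l, c l * q l * b l i) F := by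
    intro c
    have := map_hev (aeval c) D x0 x F
    simpa [x0, x, G] using this
  let H : MvPolynomial (Fin (n+1)) K :=
    (∏ k, ∏ l ∈ Finset.univ.erase k, (X k - X l)) * (∏ k, X k) * (∏ k, (X k + 1)) * x0
  have hx0 : x0 ≠ 0 := by
    intro h
    have := congrArg (eval (1 : Fin (n+1) → K)) h
    simp [x0, hq1] at this
  have hH : H ≠ 0 := by
    refine mul_ne_zero (mul_ne_zero (mul_ne_zero ?_ ?_) ?_) hx0
    · refine Finset.prod_ne_zero_iff.2 fun k _ => Finset.prod_ne_zero_iff.2 fun l hl => ?_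
      rw [sub_ne_zero]
      intro h
      have := X_injective h
      simp [this] at hl
    · exact Finset.prod_ne_zero_iff.2 fun k _ => X_ne_zero k
    · refine Finset.prod_ne_zero_iff.2 fun k _ h => ?_
      have := congrArg (eval (0 : Fin (n+1) → K)) h
      simp at this
  have hGH : G * H = 0 := by
    apply MvPolynomial.funext
    intro c
    rw [map_mul, map_zero]
    by_cases h : eval c H = 0
    · rw [h, mul_zero]
    · rw [hG]
      simp only [H, map_mul, mul_ne_zero_iff, map_prod, Finset.prod_ne_zero_iff, ← ne_eq] at h
      obtain ⟨⟨⟨h1, h2⟩, h3⟩, h4⟩ := h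
      rw [curve_vanish b q pl hq1 hpl M Ml D F hF hM hMl hsum c, zero_mul]
      · intro k l hkl
        by_contra hne
        apply h1 k (Finset.mem_univ _) l (by simp [Ne.symm hne])
        simp [hkl]
      · intro l; simpa using h2 l (Finset.mem_univ _)
      · intro l; simpa using h3 l (Finset.mem_univ _)
      · simpa [x0] using h4
  have hG0 : G = 0 := (mul_eq_zero.1 hGH).resolve_right hH
  apply MvPolynomial.funext
  intro y
  obtain ⟨r, hr1, hr⟩ := hspan y
  have := hG (fun l => r l / q l)
  rw [hG0, map_zero] at this
  have e : ∀ l, r l / q l * q l = r l := fun l => div_mul_cancel₀ _ (hq0 l)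
  simp only [e, hr1, ← hr] at this
  rw [hev_field _ _ one_ne_zero _ _ hF] at this
  simpa [aeval_eq_eval] using this.symm

end B

section C
open MvPolynomial
variable {K : Type*} [Field K] {n : ℕ}

lemma exists_linear {s : ℕ} (p : Fin s → Fin n → K) (J : Finset (Fin s)) (hJ : J.card ≤ n) :
    ∃ G : MvPolynomial (Fin n) K, G ≠ 0 ∧ G.totalDegree ≤ 1 ∧ ∀ j ∈ J, aeval (p j) G = 0 := by
  classical
  let Φ : (K × (Fin n → K)) →ₗ[K] (J → K) :=
    { toFun := fun v j => v.1 + ∑ i, v.2 i * p j i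
      map_add' := by
        intro v w; funext j
        simp only [Prod.fst_add, Prod.snd_add, Pi.add_apply, add_mul, Finset.sum_add_distrib]
        ring
      map_smul' := by
        intro a v; funext j
        simp [mul_add, Finset.mul_sum, mul_assoc] }
  have hk : LinearMap.ker Φ ≠ ⊥ := by
    apply LinearMap.ker_ne_bot_of_finrank_lt
    simp
    omega
  obtain ⟨v, hv, hv0⟩ := Submodule.exists_mem_ne_zero_of_ne_bot hk
  have hev : ∀ y : Fin n → K, aeval y (C v.1 + ∑ i, C (v.2 i) * X i : MvPolynomial (Fin n) K) =
      v.1 + ∑ i, v.2 i * y i := by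
    intro y; simp
  refine ⟨C v.1 + ∑ i, C (v.2 i) * X i, ?_, ?_, ?_⟩
  · intro h
    have h0 : ∀ y : Fin n → K, v.1 + ∑ i, v.2 i * y i = 0 := by
      intro y; rw [← hev, h, map_zero]
    have h1 : v.1 = 0 := by simpa using h0 0
    apply hv0
    ext i
    · exact h1
    · simpa [h1, Pi.single_apply] using h0 (Pi.single i 1)
  · refine (totalDegree_add _ _).trans (max_le (by simp) ?_)
    apply totalDegree_finsetSum_le
    intro i _
    refine (totalDegree_mul _ _).trans ?_
    simp
  · intro j hj
    rw [hev]
    exact congrFun (LinearMap.mem_ker.1 hv) ⟨j, hj⟩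

lemma exists_poly {s : ℕ} (p : Fin s → Fin n → K) (d : ℕ) (m : Fin s → ℕ)
    (h1 : ∀ i, m i ≤ d) (h2 : ∑ i, m i ≤ n * d) :
    ∃ F : MvPolynomial (Fin n) K, F ≠ 0 ∧ F.totalDegree ≤ d ∧ ∀ i, HasMul (p i) (m i) F := by
  classical
  induction d generalizing m with
  | zero =>
    refine ⟨1, one_ne_zero, by simp, fun i => ?_⟩
    rw [Nat.le_zero.1 (h1 i)]
    exact HasMul.zero _ _
  | succ d ih =>
    have : ∃ J : Finset (Fin s), J.card ≤ n ∧ (∀ i, m i = d + 1 → i ∈ J) ∧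
        ∑ i, (m i - if i ∈ J then 1 else 0) ≤ n * d := by
      let T := Finset.univ.filter fun i => m i = d + 1
      let S := Finset.univ.filter fun i => 0 < m i
      have hTS : T ⊆ S := by
        intro i; simp only [T, S, Finset.mem_filter]; rintro ⟨a, b⟩; exact ⟨a, by omega⟩
      have hT : T.card ≤ n := by
        have : T.card * (d + 1) ≤ n * (d + 1) := by
          refine le_trans ?_ h2
          rw [← smul_eq_mul]
          refine le_trans ?_ (Finset.sum_le_univ_sum_of_nonneg (s := T) (by simp))
          apply Finset.card_nsmul_le_sum
          intro i hi
          simp only [T, Finset.mem_filter] at hi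
          omega
        exact Nat.le_of_mul_le_mul_right this (by omega)
      by_cases hS : n ≤ S.card
      · obtain ⟨J, hTJ, hJS, hJ⟩ := Finset.exists_subsuperset_card_eq hTS hT hS
        refine ⟨J, hJ.le, fun i hi => hTJ (by simp [T, hi]), ?_⟩
        have : ∑ i, (m i - if i ∈ J then 1 else 0) + J.card = ∑ i, m i := by
          have e : J.card = ∑ i, if i ∈ J then 1 else 0 := by simp
          rw [e, ← Finset.sum_add_distrib]
          apply Finset.sum_congr rfl
          intro i _
          split_ifs with hi
          · have := hJS hi
            simp only [S, Finset.mem_filter] at this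
            omega
          · omega
        rw [mul_add] at h2
        omega
      · refine ⟨S, by omega, fun i hi => hTS (by simp [T, hi]), ?_⟩
        calc ∑ i, (m i - if i ∈ S then 1 else 0) ≤ ∑ i, if i ∈ S then d else 0 := by
              apply Finset.sum_le_sum
              intro i _
              have := h1 i
              by_cases hi : i ∈ S
              · simp only [hi, if_true]; omega
              · simp only [hi, if_false]
                simp only [S, Finset.mem_filter, Finset.mem_univ, true_and] at hi
                omega
          _ = S.card * d := by simp
          _ ≤ n * d := Nat.mul_le_mul_right _ (by omega)
    obtain ⟨J, hJ, hJT, hsum⟩ := this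
    obtain ⟨F, hF0, hFd, hFm⟩ := ih (fun i => m i - if i ∈ J then 1 else 0) (by
      intro i
      have := h1 i
      by_cases hi : i ∈ J
      · simp only [hi, if_true]; omega
      · have : m i ≠ d + 1 := fun h => hi (hJT i h)
        simp only [hi, if_false]; omega) hsum
    obtain ⟨G, hG0, hGd, hGm⟩ := exists_linear p J hJ
    refine ⟨F * G, mul_ne_zero hF0 hG0, (totalDegree_mul _ _).trans (by omega), fun i => ?_⟩
    by_cases hi : i ∈ J
    · refine ((hFm i).mul (HasMul.one (hGm i hi))).mono ?_
      simp only [hi, if_true]; omega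
    · refine ((hFm i).mul (HasMul.zero _ G)).mono ?_
      simp [hi]

lemma lower [CharZero K] {s : ℕ} (p : Fin s → Fin n → K) (D : ℕ) (M : Fin s → ℕ)
    (F : MvPolynomial (Fin n) K) (hF0 : F ≠ 0) (hFd : F.totalDegree + n ≤ D)
    (hFm : ∀ i, HasMul (p i) (M i) F) (t : ℕ) :
    (t + 1) ^ n ≤ Module.finrank K (Lsys K n s (t * D) (fun i => t * M i) p) := by
  classical
  let e : (Fin n → Fin (t+1)) → (Fin n →₀ ℕ) := fun γ =>
    Finsupp.equivFunOnFinite.symm fun i => (γ i : ℕ)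
  have he : Function.Injective e := by
    intro a b h
    funext i
    have := DFunLike.congr_fun h i
    exact Fin.ext this
  let f : (Fin n → Fin (t+1)) → MvPolynomial (Fin n) K := fun γ => F ^ t * monomial (e γ) 1
  have hf : ∀ γ, f γ ∈ Lsys K n s (t * D) (fun i => t * M i) p := by
    intro γ
    rw [mem_Lsys]
    constructor
    · refine (totalDegree_mul _ _).trans ?_
      have h1 := totalDegree_pow F t
      have h2 : (monomial (e γ) (1:K)).totalDegree ≤ t * n := by
        rw [totalDegree_monomial _ one_ne_zero, Finsupp.sum_fintype _ _ (by simp)]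
        calc ∑ i, e γ i ≤ ∑ i : Fin n, t := Finset.sum_le_sum fun i _ => by
              have := (γ i).2
              simp only [e, Finsupp.equivFunOnFinite_symm_apply_apply]; omega
          _ = t * n := by simp [mul_comm]
      nlinarith
    · intro i
      simpa using ((hFm i).pow t).mul (HasMul.zero (p i) (monomial (e γ) 1))
  have hli : LinearIndependent K f := by
    have h1 : LinearIndependent K (fun γ => monomial (e γ) (1 : K)) := by
      have := (basisMonomials (Fin n) K).linearIndependent.comp e he
      simpa [Function.comp_def] using this
    exact h1.map' (LinearMap.mulLeft K (F ^ t)) (LinearMap.ker_eq_bot.2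
      (mul_right_injective₀ (pow_ne_zero _ hF0)))
  have hli2 : LinearIndependent K
      (fun γ => (⟨f γ, hf γ⟩ : Lsys K n s (t * D) (fun i => t * M i) p)) :=
    LinearIndependent.of_comp (Submodule.subtype _) hli
  have : Module.Finite K (Lsys K n s (t * D) (fun i => t * M i) p) :=
    Submodule.finiteDimensional_of_le (S₂ := restrictTotalDegree (Fin n) K (t * D)) inf_le_left
  simpa using hli2.fintype_card_le_finrank

lemma upper {k : ℕ} (L : Submodule K (MvPolynomial (Fin (k+1)) K)) (D : ℕ)
    (hL : ∀ F ∈ L, (∀ β : Fin (k+1) →₀ ℕ, β.degree = D → coeff β F = 0) → F = 0) :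
    Module.finrank K L ≤ (D + 1) ^ k := by
  classical
  let e : (Fin k → Fin (D+1)) → (Fin (k+1) →₀ ℕ) := fun γ =>
    Finsupp.equivFunOnFinite.symm (Fin.cons (D - ∑ j, (γ j : ℕ)) fun j => (γ j : ℕ))
  let Φ : L →ₗ[K] ((Fin k → Fin (D+1)) → K) :=
    LinearMap.pi fun γ => (lcoeff K (e γ)) ∘ₗ L.subtype
  have hΦ : Function.Injective Φ := by
    rw [← LinearMap.ker_eq_bot, LinearMap.ker_eq_bot']
    rintro ⟨F, hF⟩ h
    have := hL F hF (by
      intro β hβ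
      have hs := hβ
      rw [Finsupp.degree_eq_sum, Fin.sum_univ_succ] at hs
      have hle : ∀ j : Fin k, β j.succ < D + 1 := by
        intro j
        have := Finset.single_le_sum (f := fun j : Fin k => β j.succ) (fun _ _ => Nat.zero_le _)
          (Finset.mem_univ j)
        omega
      have h2 := congrFun h (fun j => ⟨β j.succ, hle j⟩)
      have h3 : e (fun j => ⟨β j.succ, hle j⟩) = β := by
        ext i
        refine Fin.cases ?_ (fun j => ?_) i
        · simp only [e, Finsupp.equivFunOnFinite_symm_apply_apply, Fin.cons_zero]
          omega
        · simp [e]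
      simp only [Φ, LinearMap.pi_apply, h3] at h2
      exact h2)
    exact Subtype.ext this
  have := LinearMap.finrank_le_finrank_of_injective hΦ
  simpa using this

lemma exists_degree_eq (F : MvPolynomial (Fin n) K) (hF : F ≠ 0) :
    ∃ β : Fin n →₀ ℕ, β.degree = F.totalDegree ∧ coeff β F ≠ 0 := by
  obtain ⟨β, hβ, h⟩ := Finset.exists_mem_eq_sup F.support (support_nonempty.2 hF)
    (fun s => s.sum fun _ e => e)
  exact ⟨β, h.symm, mem_support_iff.1 hβ⟩

lemma vanish_one (p : Fin n → K) (M : ℕ) (F : MvPolynomial (Fin n) K)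
    (hF : F.totalDegree < M) (hM : HasMul p M F) : F = 0 := by
  apply shf_injective p
  rw [map_zero]
  ext β
  rw [coeff_zero]
  by_contra h
  exact h (hM β (lt_of_le_of_lt (degree_le_of_mem (shf_totalDegree_le p F)
    (mem_support_iff.2 h)) hF))

lemma span_of_indep (b : Fin (n+1) → Fin n → K) (hb : AffineIndependent K b) (y : Fin n → K) :
    ∃ r : Fin (n+1) → K, ∑ l, r l = 1 ∧ ∀ i, y i = ∑ l, r l * b l i := by
  have htop : affineSpan K (Set.range b) = ⊤ := by
    rw [hb.affineSpan_eq_top_iff_card_eq_finrank_add_one]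
    simp
  let B : AffineBasis (Fin (n+1)) K (Fin n → K) := ⟨b, hb, htop⟩
  refine ⟨fun l => B.coord l y, B.sum_coord_apply_eq_one y, fun i => ?_⟩
  have := congrFun (B.linear_combination_coord_eq_self y) i
  rw [← this, Finset.sum_apply]
  simp only [Pi.smul_apply, smul_eq_mul]
  rfl

lemma vanish_all [CharZero K] (s : ℕ) (hs2 : s ≤ n + 2) (hs1 : n + 1 ≤ s)
    (p : Fin s → Fin n → K)
    (hgen : ∀ I : Finset (Fin s), I.card ≤ n + 1 →
      AffineIndependent K (fun i : {x // x ∈ I} => p i.1))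
    (M : Fin s → ℕ) (F : MvPolynomial (Fin n) K)
    (hM : ∀ i, HasMul (p i) (M i) F) (hsum : n * F.totalDegree < ∑ i, M i) : F = 0 := by
  have hind : ∀ f : Fin (n+1) ↪ Fin s, AffineIndependent K (fun l => p (f l)) := by
    intro f
    have := hgen (Finset.univ.map f) (by simp)
    exact this.comp_embedding ⟨fun l => ⟨f l, by simp⟩, fun a b h => f.injective (congrArg Subtype.val h)⟩
  have hs : s = n + 1 ∨ s = n + 2 := by omega
  rcases hs with rfl | rfl
  · have hb := hind (Function.Embedding.refl _)
    refine vanish p (fun _ => ((n : K) + 1)⁻¹) (fun i => ∑ l, ((n : K) + 1)⁻¹ * p l i)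
      (span_of_indep p hb) (fun _ => inv_ne_zero (by exact_mod_cast Nat.succ_ne_zero n)) ?_ (fun _ => rfl) M 0
      F.totalDegree F le_rfl hM (HasMul.zero _ _) (by simpa using hsum)
    simp only [Finset.sum_const, Finset.card_univ, Fintype.card_fin, nsmul_eq_mul]
    push_cast
    exact mul_inv_cancel₀ (by exact_mod_cast Nat.succ_ne_zero n)
  · have hb := hind Fin.castSuccEmb
    obtain ⟨q, hq1, hq⟩ := span_of_indep _ hb (p (Fin.last _))
    refine vanish _ q (p (Fin.last _)) (span_of_indep _ hb) ?_ hq1 hq (fun l => M l.castSucc)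
      (M (Fin.last _)) F.totalDegree F le_rfl (fun l => hM _) (hM _) ?_
    · intro l hl
      have h1 := hind (Fin.succAboveEmb l.castSucc)
      rw [affineIndependent_iff] at h1
      let w : Fin (n+2) → K := Fin.snoc q (-1)
      have hw0 : w l.castSucc = 0 := by simp [w, hl]
      have hne : Fin.last (n+1) ≠ l.castSucc := (Fin.castSucc_lt_last l).ne'
      obtain ⟨j, hj⟩ := Fin.exists_succAbove_eq hne
      have := h1 Finset.univ (fun j => w (l.castSucc.succAbove j)) ?_ ?_ j (Finset.mem_univ _)
      · simp [hj, w] at this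
      · have e := Fin.sum_univ_succAbove w l.castSucc
        rw [hw0, zero_add] at e
        rw [← e, Fin.sum_univ_castSucc]
        simp [w, hq1]
      · have e := Fin.sum_univ_succAbove (fun j => w j • p j) l.castSucc
        simp only [hw0, zero_smul, zero_add] at e
        change ∑ j, w (l.castSucc.succAbove j) • p (l.castSucc.succAbove j) = 0
        rw [← e, Fin.sum_univ_castSucc]
        funext i
        simp [w, hq, Finset.sum_apply]
    · rw [Fin.sum_univ_castSucc] at hsum
      exact hsum

end C

/-- The big cone of the blow-up of `ℙⁿ` at `s ≤ n + 2` points in general position: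
`D = dH - Σ mᵢ Eᵢ` is big iff `d > 0`, `mᵢ < d` for all `i`, and `Σ_{i∈I} mᵢ < n·d`
for all `I` with `|I| = n+1, n+2`. -/
theorem stmt_5 {K : Type*} [Field K] [IsAlgClosed K] [CharZero K]
    (n s : ℕ) (hn : 1 ≤ n) (hs1 : 1 ≤ s) (hs2 : s ≤ n + 2)
    (p : Fin s → Fin n → K)
    (hgen : ∀ I : Finset (Fin s), I.card ≤ n + 1 →
      AffineIndependent K (fun i : {x // x ∈ I} => p i.1)) :
    ∀ (d : ℕ) (m : Fin s → ℕ),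
      ((∃ c : ℝ, 0 < c ∧ ∀ N : ℕ, ∃ ν : ℕ, N ≤ ν ∧
          c * (ν : ℝ) ^ n ≤
            (Module.finrank K ↥(Lsys K n s (ν * d) (fun i => ν * m i) p) : ℝ)) ↔
        (0 < d ∧ (∀ i, m i < d) ∧
          ∀ I : Finset (Fin s), (I.card = n + 1 ∨ I.card = n + 2) →
            (∑ i ∈ I, m i) < n * d)) := by
  classical
  intro d m
  constructor
  · rintro ⟨c, hc, hN⟩
    obtain ⟨k, rfl⟩ : ∃ k, n = k + 1 := ⟨n - 1, by omega⟩
    by_contra hcon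
    have hZ : ∀ ν : ℕ, ∀ F ∈ Lsys K (k+1) s (ν * d) (fun i => ν * m i) p,
        (∀ β : Fin (k+1) →₀ ℕ, β.degree = ν * d → MvPolynomial.coeff β F = 0) → F = 0 := by
      intro ν F hF htop
      rw [mem_Lsys] at hF
      obtain ⟨hFd, hFm⟩ := hF
      by_contra hF0
      obtain ⟨β, hβ, hβ0⟩ := exists_degree_eq F hF0
      have hlt : F.totalDegree < ν * d := by
        refine lt_of_le_of_ne hFd fun h => hβ0 (htop β (by rw [hβ, h]))
      by_cases hA : ∃ i, d ≤ m i
      · obtain ⟨i, hi⟩ := hA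
        exact hF0 (vanish_one (p i) _ F (hlt.trans_le (Nat.mul_le_mul_left _ hi)) (hFm i))
      · push Not at hA
        have hd : 0 < d := lt_of_le_of_lt (Nat.zero_le _) (hA ⟨0, hs1⟩)
        have hB : ∃ I : Finset (Fin s), (I.card = k + 1 + 1 ∨ I.card = k + 1 + 2) ∧
            (k + 1) * d ≤ ∑ i ∈ I, m i := by
          by_contra hB
          push Not at hB
          exact hcon ⟨hd, hA, hB⟩
        obtain ⟨I, hI, hIs⟩ := hB
        have hIc : I.card ≤ s := by simpa using Finset.card_le_univ I
        refine hF0 (vanish_all s hs2 (by omega) p hgen _ F hFm ?_)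
        have h1 : ∑ i ∈ I, m i ≤ ∑ i, m i := Finset.sum_le_univ_sum_of_nonneg (by simp)
        rw [← Finset.mul_sum]
        calc (k + 1) * F.totalDegree < (k + 1) * (ν * d) := by
              exact Nat.mul_lt_mul_of_pos_left hlt (by omega)
          _ = ν * ((k + 1) * d) := by ring
          _ ≤ ν * ∑ i, m i := Nat.mul_le_mul_left _ (hIs.trans h1)
    obtain ⟨N, hNc⟩ := exists_nat_gt (((d : ℝ) + 1) ^ k / c)
    obtain ⟨ν, hν, hle⟩ := hN (N + 1)
    have hup : (Module.finrank K ↥(Lsys K (k+1) s (ν * d) (fun i => ν * m i) p) : ℝ) ≤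
        ((ν : ℝ) * d + 1) ^ k := by
      exact_mod_cast upper _ (ν * d) (hZ ν)
    have hν1 : (1 : ℝ) ≤ ν := by exact_mod_cast (by omega : 1 ≤ ν)
    have hνN : (N : ℝ) ≤ ν := by exact_mod_cast (by omega : N ≤ ν)
    have h2 : ((ν : ℝ) * d + 1) ^ k ≤ (ν : ℝ) ^ k * ((d : ℝ) + 1) ^ k := by
      rw [← mul_pow]
      apply pow_le_pow_left₀ (by positivity)
      nlinarith
    have h3 : (ν : ℝ) ^ k * (c * ν) ≤ (ν : ℝ) ^ k * ((d : ℝ) + 1) ^ k := by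
      calc (ν : ℝ) ^ k * (c * ν) = c * (ν : ℝ) ^ (k + 1) := by ring
        _ ≤ _ := hle.trans (hup.trans h2)
    have h4 := le_of_mul_le_mul_left h3 (by positivity)
    rw [div_lt_iff₀ hc] at hNc
    nlinarith
  · rintro ⟨hd, hm, hI⟩
    have hsum : n ^ 2 * ∑ i, m i + n ^ 2 ≤ n ^ 2 * (n * d) := by
      have : ∑ i, m i < n * d := by
        by_cases hs : n + 1 ≤ s
        · apply hI
          simp only [Finset.card_univ, Fintype.card_fin]
          omega
        · calc ∑ i, m i < ∑ i : Fin s, d :=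
                Finset.sum_lt_sum_of_nonempty ⟨⟨0, hs1⟩, Finset.mem_univ _⟩ fun i _ => hm i
            _ = s * d := by simp
            _ ≤ n * d := Nat.mul_le_mul_right _ (by omega)
      calc n ^ 2 * ∑ i, m i + n ^ 2 = n ^ 2 * (∑ i, m i + 1) := by ring
        _ ≤ _ := Nat.mul_le_mul_left _ this
    have hnn : n ≤ n ^ 2 * d := by nlinarith
    obtain ⟨F, hF0, hFd, hFm⟩ := exists_poly p (n ^ 2 * d - n) (fun i => n ^ 2 * m i) (by
      intro i
      have := hm i
      have h1 : n ^ 2 * (m i + 1) ≤ n ^ 2 * d := Nat.mul_le_mul_left _ this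
      have h2 : n ≤ n ^ 2 := by nlinarith
      rw [mul_add] at h1
      omega) (by
      rw [← Finset.mul_sum, Nat.mul_sub]
      have e1 : n * (n ^ 2 * d) = n ^ 2 * (n * d) := by ring
      have e2 : n * n = n ^ 2 := by ring
      omega)
    refine ⟨(((n : ℝ) ^ 2) ^ n)⁻¹, by positivity, fun N => ⟨N * n ^ 2, Nat.le_mul_of_pos_right N (by positivity), ?_⟩⟩
    have := lower p (n ^ 2 * d) (fun i => n ^ 2 * m i) F hF0 (by omega) hFm N
    have h1 : ((N : ℝ) + 1) ^ n ≤
        (Module.finrank K ↥(Lsys K n s (N * n ^ 2 * d) (fun i => N * n ^ 2 * m i) p) : ℝ) := by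
      rw [show (fun i => N * n ^ 2 * m i) = fun i => N * (n ^ 2 * m i) from
        funext fun i => mul_assoc _ _ _, mul_assoc N (n ^ 2) d]
      exact_mod_cast this
    refine le_trans ?_ h1
    push_cast
    have hn0 : ((n : ℝ) ^ 2) ^ n ≠ 0 := by positivity
    rw [mul_pow, mul_comm ((N : ℝ) ^ n), ← mul_assoc, inv_mul_cancel₀ hn0, one_mul]
    exact pow_le_pow_left₀ (by positivity) (by linarith) n
end

section
/- Let n ≥ 2. There exist points p_1, …, p_{n+3} ∈ ℂ^n (a configuration in general position) such that for all integers d ≥ 0 and m_1, …, m_{n+3} ≥ 0 the following are equivalent: (1) there exist a real constant c > 0 and infinitely many ν ∈ ℕ such that dim_ℂ L_{n,ν·d}(ν·m_1, …, ν·m_{n+3}) ≥ c·ν^n (i.e. the divisor D = dH − Σ m_i E_i on the blow-up of ℙ^n at the points is big); (2) d > 0, m_i < d for every i, Σ_{i∈I} m_i < n·d for every I with |I| = n+1 or |I| = n+2, and for every integer t ≥ 1 and every I ⊆ {1,…,n+3} with |I| = n − 2t + 1 ≥ 0 one has t·Σ_{i=1}^{n+3} m_i + Σ_{i∈I} m_i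 < ((n+1)t + |I| − 1)·d. (Theorem on the big cone of the blow-up of ℙ^n at n+3 points in general position; the last family of strict inequalities says that the multiplicities of containment k_{I,σ_t} of the joins of linear cycles with the secant varieties of the rational normal curve are negative.) -/
namespace BigCone
open MvPolynomial Finset

/-- Multihomogenization: substitute `A i / B i` and clear denominators `∏ B i ^ e i`. -/
noncomputable def MH {N : ℕ} (F : MvPolynomial (Fin N) ℂ) (e : Fin N → ℕ)
    (A B : Fin N → MvPolynomial (Fin N) ℂ) : MvPolynomial (Fin N) ℂ :=
  ∑ α ∈ F.support, C (coeff α F) * ∏ i, (A i ^ α i * B i ^ (e i - α i))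

lemma eval_MH {N : ℕ} (F : MvPolynomial (Fin N) ℂ) (e : Fin N → ℕ)
    (he : ∀ i, F.degreeOf i ≤ e i)
    (A B : Fin N → MvPolynomial (Fin N) ℂ) (c : Fin N → ℂ) (hB : ∀ i, eval c (B i) ≠ 0) :
    eval c (MH F e A B) =
      (∏ i, eval c (B i) ^ e i) * eval (fun i => eval c (A i) / eval c (B i)) F := by
  rw [MH, map_sum, eval_eq' _ F, Finset.mul_sum]
  refine Finset.sum_congr rfl fun α hα => ?_
  simp only [map_mul, eval_C, map_prod, map_pow]
  rw [mul_left_comm, ← Finset.prod_mul_distrib]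
  congr 1
  refine Finset.prod_congr rfl fun i _ => ?_
  have h1 : α i ≤ e i := (degreeOf_le_iff.1 (he i)) α hα
  rw [div_pow, ← Nat.sub_add_cancel h1, Nat.add_sub_cancel, pow_add]
  have := pow_ne_zero (α i) (hB i)
  field_simp

/-- Two polynomials agreeing off a hypersurface agree. -/
lemma eq_of_eval_off {N : ℕ} (P Q R : MvPolynomial (Fin N) ℂ) (hR : R ≠ 0)
    (h : ∀ c, eval c R ≠ 0 → eval c P = eval c Q) : P = Q := by
  have : R * (P - Q) = 0 := by
    apply MvPolynomial.funext
    intro c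
    by_cases hc : eval c R = 0
    · simp [hc]
    · simp [h c hc]
  rcases mul_eq_zero.1 this with h | h
  · exact absurd h hR
  · exact sub_eq_zero.1 h

lemma exists_eval_ne {N : ℕ} {P : MvPolynomial (Fin N) ℂ} (hP : P ≠ 0) : ∃ c, eval c P ≠ 0 := by
  by_contra! h
  exact hP (MvPolynomial.funext (by simpa using h))

/-- the linear form `c_i` minus the linear interpolation from the `j, k` values -/
noncomputable def ell {N : ℕ} (τ : Fin N → ℂ) (j k i : Fin N) : MvPolynomial (Fin N) ℂ :=
  X i - C ((τ i - τ k) / (τ j - τ k)) * X j - C ((τ i - τ j) / (τ k - τ j)) * X k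

noncomputable def flipA {N : ℕ} (τ : Fin N → ℂ) (j k i : Fin N) : MvPolynomial (Fin N) ℂ :=
  if i = j ∨ i = k then 0 else C ((τ i - τ j) * (τ i - τ k))

noncomputable def flipB {N : ℕ} (τ : Fin N → ℂ) (j k i : Fin N) : MvPolynomial (Fin N) ℂ :=
  if i = j ∨ i = k then 1 else ell τ j k i

lemma ell_symm {N : ℕ} (τ : Fin N → ℂ) (j k i : Fin N) : ell τ j k i = ell τ k j i := by
  unfold ell; ring

lemma flipA_symm {N : ℕ} (τ : Fin N → ℂ) (j k : Fin N) : flipA τ j k = flipA τ k j := by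
  ext1 i; unfold flipA; simp only [or_comm, mul_comm]

lemma flipB_symm {N : ℕ} (τ : Fin N → ℂ) (j k : Fin N) : flipB τ j k = flipB τ k j := by
  ext1 i; unfold flipB; rw [ell_symm]; simp only [or_comm]

lemma eval_ell {N : ℕ} (τ : Fin N → ℂ) (j k i : Fin N) (c : Fin N → ℂ) :
    eval c (ell τ j k i) =
      c i - (τ i - τ k) / (τ j - τ k) * c j - (τ i - τ j) / (τ k - τ j) * c k := by
  simp [ell]

/-- The class `(d, e)` is effective. -/
def Good {N : ℕ} (τ : Fin N → ℂ) (d : ℕ) (e : Fin N → ℕ) (F : MvPolynomial (Fin N) ℂ) : Prop :=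
  F ≠ 0 ∧ F.IsHomogeneous d ∧ (∀ i, F.degreeOf i ≤ e i) ∧
    ∀ (a b : ℂ) (c : Fin N → ℂ), eval (fun i => c i + a + b * τ i) F = eval c F

lemma eval_smul_hom {N d : ℕ} {F : MvPolynomial (Fin N) ℂ} (h : F.IsHomogeneous d) (s : ℂ)
    (c : Fin N → ℂ) : eval (fun i => s * c i) F = s ^ d * eval c F := by
  rw [eval_eq', eval_eq', Finset.mul_sum]
  refine Finset.sum_congr rfl fun α hα => ?_
  have : ∑ i, α i = d := by
    have := h.degree_eq_sum_deg_support hα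
    rw [this]
    symm
    apply Finset.sum_subset (Finset.subset_univ _)
    intro x _ hx; simpa using hx
  simp_rw [mul_pow]
  rw [Finset.prod_mul_distrib, Finset.prod_pow_eq_pow_sum, this]; ring

lemma sum_of_hom {N d : ℕ} {F : MvPolynomial (Fin N) ℂ} (h : F.IsHomogeneous d)
    {α} (hα : α ∈ F.support) : ∑ i, α i = d := by
  have := h.degree_eq_sum_deg_support hα
  rw [this]
  symm
  apply Finset.sum_subset (Finset.subset_univ _)
  intro x _ hx; simpa using hx

lemma ell_ne_zero {N : ℕ} (τ : Fin N → ℂ) {j k i : Fin N} (hij : i ≠ j) (hik : i ≠ k) :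
    ell τ j k i ≠ 0 := by
  intro h
  have := eval_ell τ j k i (fun l => if l = i then 1 else 0)
  rw [h] at this
  simp [hij.symm, hik.symm] at this

lemma degreeOf_ell_le {N : ℕ} (τ : Fin N → ℂ) (j k i v : Fin N) :
    (ell τ j k i).degreeOf v ≤ if v = i ∨ v = j ∨ v = k then 1 else 0 := by
  unfold ell
  refine (degreeOf_sub_le _ _ _).trans (max_le ((degreeOf_sub_le _ _ _).trans (max_le ?_ ?_)) ?_)
  · rw [degreeOf_X]; split_ifs <;> simp_all
  · refine (degreeOf_C_mul_le _ _ _).trans ?_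
    rw [degreeOf_X]; split_ifs <;> simp_all
  · refine (degreeOf_C_mul_le _ _ _).trans ?_
    rw [degreeOf_X]; split_ifs <;> simp_all

lemma degreeOf_MH_le {N : ℕ} (F : MvPolynomial (Fin N) ℂ) (e : Fin N → ℕ)
    (A B : Fin N → MvPolynomial (Fin N) ℂ) (v : Fin N) (K : ℕ)
    (h : ∀ α ∈ F.support, (∃ i, α i ≠ 0 ∧ A i = 0) ∨
      ∑ i, (α i * (A i).degreeOf v + (e i - α i) * (B i).degreeOf v) ≤ K) :
    (MH F e A B).degreeOf v ≤ K := by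
  unfold MH
  refine (degreeOf_sum_le _ _ _).trans (Finset.sup_le fun α hα => ?_)
  refine (degreeOf_C_mul_le _ _ _).trans ?_
  rcases h α hα with ⟨i, hi, hA⟩ | h
  · rw [Finset.prod_eq_zero (Finset.mem_univ i) (by simp [hA, hi])]; simp
  · refine (degreeOf_prod_le _ _ _).trans (le_trans (Finset.sum_le_sum fun i _ => ?_) h)
    refine (degreeOf_mul_le _ _ _).trans (add_le_add ?_ ?_)
    · exact degreeOf_pow_le _ _ _
    · exact degreeOf_pow_le _ _ _

lemma flipB_ne_zero {N : ℕ} (τ : Fin N → ℂ) (j k i : Fin N) : flipB τ j k i ≠ 0 := by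
  unfold flipB; split_ifs with h
  · exact one_ne_zero
  · push Not at h; exact ell_ne_zero τ h.1 h.2

lemma ell_transl {N : ℕ} (τ : Fin N → ℂ) (hτ : Function.Injective τ) {j k : Fin N} (hjk : j ≠ k)
    (i : Fin N) (a b : ℂ) (c : Fin N → ℂ) :
    eval (fun i => c i + a + b * τ i) (ell τ j k i) = eval c (ell τ j k i) := by
  have h1 : τ j - τ k ≠ 0 := sub_ne_zero.2 (hτ.ne hjk)
  have h2 : τ k - τ j ≠ 0 := sub_ne_zero.2 (hτ.ne hjk.symm)
  rw [eval_ell, eval_ell, ← neg_sub (τ j) (τ k)]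
  field_simp
  ring

/-- degree in `c_j` of the flipped polynomial -/
lemma flip_degree {N : ℕ} (τ : Fin N → ℂ) (hτ : Function.Injective τ) (d : ℕ) (e : Fin N → ℕ)
    (F : MvPolynomial (Fin N) ℂ) (hF : Good τ d e F) {j k : Fin N} (hjk : j ≠ k)
    (hne : MH F e (flipA τ j k) (flipB τ j k) ≠ 0) :
    (MH F e (flipA τ j k) (flipB τ j k)).degreeOf j + 2 * d + e j ≤ ∑ i, e i := by
  obtain ⟨hF0, hFd, hFe, hFt⟩ := hF
  have hjk0 : τ j - τ k ≠ 0 := sub_ne_zero.2 (hτ.ne hjk)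
  have hkj0 : τ k - τ j ≠ 0 := sub_ne_zero.2 (hτ.ne hjk.symm)
  -- alternate numerators
  set A' : Fin N → MvPolynomial (Fin N) ℂ := fun i =>
    if i = j then 0 else if i = k then C ((τ k - τ j)) else
      C (τ i - τ j) * (X i - C ((τ i - τ j) / (τ k - τ j)) * X k) with hA'
  have key : MH F e (flipA τ j k) (flipB τ j k) * X j ^ d =
      C ((τ j - τ k) ^ d) * MH F e A' (flipB τ j k) := by
    refine eq_of_eval_off _ _ (X j * ∏ i, flipB τ j k i)
      (mul_ne_zero (X_ne_zero _) (Finset.prod_ne_zero_iff.2 fun i _ => flipB_ne_zero τ j k i)) ?_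
    intro c hc
    rw [map_mul, map_prod, mul_ne_zero_iff, Finset.prod_ne_zero_iff, eval_X] at hc
    have hB : ∀ i, eval c (flipB τ j k i) ≠ 0 := fun i => hc.2 i (Finset.mem_univ i)
    rw [map_mul, map_mul, eval_MH F e hFe _ _ c hB, eval_MH F e hFe _ _ c hB]
    simp only [map_pow, eval_X, eval_C]
    rw [mul_assoc, mul_left_comm ((τ j - τ k) ^ d)]
    congr 1
    set s : ℂ := c j / (τ j - τ k) with hs
    have hs0 : s ≠ 0 := div_ne_zero hc.1 hjk0
    have : eval (fun i => eval c (A' i) / eval c (flipB τ j k i)) F =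
        s ^ d * eval (fun i => eval c (flipA τ j k i) / eval c (flipB τ j k i)) F := by
      rw [← hFt (-τ j / s) (1 / s)
        (fun i => eval c (flipA τ j k i) / eval c (flipB τ j k i)), ← eval_smul_hom hFd]
      congr 1
      congr 1
      funext i
      have hBi := hB i
      by_cases hij : i = j
      · subst hij; simp [hA', flipA, flipB]; right; ring
      by_cases hik : i = k
      · subst hik; simp [hA', flipA, flipB, hij]; field_simp; ring
      simp only [flipB, hij, hik, or_self, if_false] at hBi
      simp only [hA', flipA, flipB, hij, hik, if_false, or_self]
      have h3 : c j = s * (τ j - τ k) := by rw [hs]; field_simp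
      have h4 : eval c (ell τ j k i) = c i - (τ i - τ j) / (τ k - τ j) * c k - s * (τ i - τ k) := by
        rw [eval_ell, h3]; field_simp
        ring
      simp only [map_mul, map_sub, eval_C, eval_X]
      rw [← sub_eq_zero]
      have h5 : c i - (τ i - τ j) / (τ k - τ j) * c k = eval c (ell τ j k i) + s * (τ i - τ k) := by
        rw [h4]; ring
      rw [h5]
      field_simp
      ring
    rw [this, hs, div_pow]
    field_simp
  have hdeg : (MH F e A' (flipB τ j k)).degreeOf j + d + e j ≤ ∑ i, e i := by
    suffices h : (MH F e A' (flipB τ j k)).degreeOf j ≤ (∑ i, e i) - d - e j by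
      -- need d + e j ≤ ∑ e
      obtain ⟨α, hα, hαj⟩ : ∃ α ∈ F.support, α j = 0 := by
        by_contra! hcon
        apply hne
        unfold MH
        refine Finset.sum_eq_zero fun α hα => ?_
        rw [Finset.prod_eq_zero (Finset.mem_univ j), mul_zero]
        simp [flipA, hcon α hα]
      have h1 := sum_of_hom hFd hα
      have h2 : ∑ i, α i + e j ≤ ∑ i, e i := by
        rw [← Finset.add_sum_erase _ _ (Finset.mem_univ j), hαj,
          ← Finset.add_sum_erase univ e (Finset.mem_univ j)]
        have : ∑ x ∈ univ.erase j, α x ≤ ∑ x ∈ univ.erase j, e x :=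
          Finset.sum_le_sum fun i _ => degreeOf_le_iff.1 (hFe i) α hα
        omega
      omega
    refine degreeOf_MH_le _ _ _ _ _ _ fun α hα => ?_
    by_cases hαj : α j = 0
    swap
    · left; exact ⟨j, hαj, by simp [hA']⟩
    right
    have hle : ∀ i, α i ≤ e i := fun i => degreeOf_le_iff.1 (hFe i) α hα
    have h1 := sum_of_hom hFd hα
    have h0 : ∀ i, (A' i).degreeOf j = 0 := by
      intro i
      simp only [hA']
      split_ifs with h1 h2
      · simp
      · exact degreeOf_C _ _
      · refine Nat.le_zero.1 ((degreeOf_C_mul_le _ _ _).trans ((degreeOf_sub_le _ _ _).trans ?_))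
        refine max_le ?_ ((degreeOf_C_mul_le _ _ _).trans ?_)
        · rw [degreeOf_X_of_ne (Ne.symm h1)]
        · rw [degreeOf_X_of_ne hjk]
    have h2 : ∀ i, α i * (A' i).degreeOf j + (e i - α i) * (flipB τ j k i).degreeOf j ≤
        if i = j then 0 else (e i - α i) := by
      intro i
      rw [h0, mul_zero, zero_add]
      by_cases hij : i = j
      · simp [flipB, hij]
      · rw [if_neg hij]
        have : (flipB τ j k i).degreeOf j ≤ 1 := by
          unfold flipB; split_ifs
          · simp
          · refine (degreeOf_ell_le _ _ _ _ _).trans ?_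
            split_ifs <;> simp
        nlinarith
    refine (Finset.sum_le_sum fun i _ => h2 i).trans ?_
    have h3 : ∑ i, ((if i = j then 0 else (e i - α i)) + α i + if i = j then e j else 0) = ∑ i, e i := by
      refine Finset.sum_congr rfl fun i _ => ?_
      have := hle i
      by_cases hij : i = j
      · subst hij; simp [hαj]
      · simp [hij]; omega
    rw [Finset.sum_add_distrib, Finset.sum_add_distrib] at h3
    simp only [Finset.sum_ite_eq', Finset.mem_univ, if_true] at h3
    omega
  have h6 := congrArg (degreeOf j) key
  rw [degreeOf_mul_X_self_pow_eq_add_of_ne_zero _ _ hne] at h6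
  have h7 := degreeOf_C_mul_le (MH F e A' (flipB τ j k)) j ((τ j - τ k) ^ d)
  omega

end BigCone

namespace BigCone
open MvPolynomial Finset

lemma isHomogeneous_ell {N : ℕ} (τ : Fin N → ℂ) (j k i : Fin N) :
    (ell τ j k i).IsHomogeneous 1 :=
  ((isHomogeneous_X _ _).sub (isHomogeneous_C_mul_X _ _)).sub (isHomogeneous_C_mul_X _ _)

lemma sum_split {N : ℕ} (f : Fin N → ℕ) {j k : Fin N} (hjk : j ≠ k) :
    ∑ i, f i = ∑ i, (if i = j ∨ i = k then 0 else f i) + f j + f k := by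
  have h : ∀ i, f i = (if i = j ∨ i = k then 0 else f i) + (if i = j then f j else 0) +
      (if i = k then f k else 0) := by
    intro i
    by_cases h1 : i = j
    · subst h1; simp [hjk]
    by_cases h2 : i = k
    · subst h2; simp [h1]
    simp [h1, h2]
  rw [Finset.sum_congr rfl fun i _ => h i, Finset.sum_add_distrib, Finset.sum_add_distrib]
  simp

lemma flip_hom {N : ℕ} (τ : Fin N → ℂ) (d : ℕ) (e : Fin N → ℕ)
    (F : MvPolynomial (Fin N) ℂ) (hF : Good τ d e F) {j k : Fin N} (hjk : j ≠ k) :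
    (MH F e (flipA τ j k) (flipB τ j k)).IsHomogeneous
      (∑ i, (if i = j ∨ i = k then 0 else e i) - d) := by
  obtain ⟨hF0, hFd, hFe, hFt⟩ := hF
  unfold MH
  refine IsHomogeneous.sum _ _ _ fun α hα => ?_
  by_cases h0 : α j = 0 ∧ α k = 0
  swap
  · have : ∃ i, α i ≠ 0 ∧ flipA τ j k i = 0 := by
      by_cases hj : α j = 0
      · exact ⟨k, fun hk => h0 ⟨hj, hk⟩, by simp [flipA]⟩
      · exact ⟨j, hj, by simp [flipA]⟩
    obtain ⟨i, hi, hA⟩ := this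
    rw [Finset.prod_eq_zero (Finset.mem_univ i) (by simp [hA, hi]), mul_zero]
    exact isHomogeneous_zero _ _ _
  refine IsHomogeneous.C_mul ?_ _
  have hs := sum_of_hom hFd hα
  have hle : ∀ i, α i ≤ e i := fun i => degreeOf_le_iff.1 (hFe i) α hα
  have : ∑ i, (if i = j ∨ i = k then 0 else e i) - d =
      ∑ i, (if i = j ∨ i = k then 0 else (e i - α i)) := by
    rw [sum_split _ hjk, h0.1, h0.2] at hs
    rw [← hs]
    have : ∑ i, (if i = j ∨ i = k then 0 else e i) = ∑ i, (if i = j ∨ i = k then 0 else (e i - α i))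
      + ∑ i, (if i = j ∨ i = k then 0 else α i) := by
      rw [← Finset.sum_add_distrib]
      refine Finset.sum_congr rfl fun i _ => ?_
      have := hle i
      split_ifs <;> omega
    omega
  rw [this]
  refine IsHomogeneous.prod _ _ _ fun i _ => ?_
  by_cases hi : i = j ∨ i = k
  · have hα0 : α i = 0 := by rcases hi with rfl | rfl <;> simp [h0]
    simp only [hi, flipA, flipB, hα0, if_true, pow_zero, one_pow, mul_one]
    exact isHomogeneous_one _ _
  · simp only [hi, flipA, flipB, if_false]
    rw [← C_pow]
    refine IsHomogeneous.C_mul ?_ _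
    simpa using (isHomogeneous_ell τ j k i).pow (e i - α i)

lemma flip_ne {N : ℕ} (τ : Fin N → ℂ) (hτ : Function.Injective τ) (d : ℕ) (e : Fin N → ℕ)
    (F : MvPolynomial (Fin N) ℂ) (hF : Good τ d e F) {j k : Fin N} (hjk : j ≠ k) :
    MH F e (flipA τ j k) (flipB τ j k) ≠ 0 := by
  obtain ⟨hF0, hFd, hFe, hFt⟩ := hF
  have hjk0 : τ j - τ k ≠ 0 := sub_ne_zero.2 (hτ.ne hjk)
  have hkj0 : τ k - τ j ≠ 0 := sub_ne_zero.2 (hτ.ne hjk.symm)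
  obtain ⟨c, hc⟩ := exists_eval_ne (mul_ne_zero hF0
    (Finset.prod_ne_zero_iff.2 fun i (_ : i ∈ univ) => flipB_ne_zero τ j k i))
  rw [map_mul, map_prod, mul_ne_zero_iff, Finset.prod_ne_zero_iff] at hc
  have hB : ∀ i, eval c (flipB τ j k i) ≠ 0 := fun i => hc.2 i (Finset.mem_univ i)
  set c' : Fin N → ℂ := fun i => if i = j ∨ i = k then 0 else
    (τ i - τ j) * (τ i - τ k) / eval c (ell τ j k i) with hc'
  have hB' : ∀ i, eval c' (flipB τ j k i) = if i = j ∨ i = k then 1 else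
      (τ i - τ j) * (τ i - τ k) / eval c (ell τ j k i) := by
    intro i
    by_cases hi : i = j ∨ i = k
    · simp [flipB, hi]
    · simp only [flipB, hi, if_false]
      rw [eval_ell]
      simp [hc', hi]
  have hBl : ∀ i, ¬ (i = j ∨ i = k) → eval c (ell τ j k i) ≠ 0 := by
    intro i hi
    simpa [flipB, hi] using hB i
  have hτi : ∀ i, ¬ (i = j ∨ i = k) → (τ i - τ j) ≠ 0 ∧ (τ i - τ k) ≠ 0 := by
    intro i hi
    push Not at hi
    exact ⟨sub_ne_zero.2 (hτ.ne hi.1), sub_ne_zero.2 (hτ.ne hi.2)⟩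
  have hB'' : ∀ i, eval c' (flipB τ j k i) ≠ 0 := by
    intro i; rw [hB']
    split_ifs with hi
    · exact one_ne_zero
    · exact div_ne_zero (mul_ne_zero (hτi i hi).1 (hτi i hi).2) (hBl i hi)
  intro h
  have h1 := eval_MH F e hFe (flipA τ j k) (flipB τ j k) c' hB''
  rw [h, map_zero] at h1
  have h2 := (mul_eq_zero.1 h1.symm).resolve_left
    (Finset.prod_ne_zero_iff.2 fun i _ => pow_ne_zero _ (hB'' i))
  apply hc.1
  rw [← h2, ← hFt ((c k * τ j - c j * τ k) / (τ k - τ j)) ((c j - c k) / (τ k - τ j)) c]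
  congr 2
  funext i
  rw [hB']
  by_cases hi : i = j
  · subst hi; simp [flipA]; field_simp; ring
  by_cases hi2 : i = k
  · subst hi2; simp [flipA]; field_simp; ring
  have hi3 : ¬ (i = j ∨ i = k) := by simp [hi, hi2]
  simp only [flipA, hi, hi2, or_self, if_false, eval_C]
  have h5 := hBl i hi3
  obtain ⟨h6, h7⟩ := hτi i hi3
  rw [div_div_eq_mul_div, mul_div_cancel_left₀ _ (mul_ne_zero h6 h7), eval_ell,
    ← neg_sub (τ k) (τ j)]
  field_simp
  ring

/-- The class `(d, e)` is effective (integers version). -/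
def Eff {N : ℕ} (τ : Fin N → ℂ) (d : ℤ) (e : Fin N → ℤ) : Prop :=
  ∃ (d' : ℕ) (e' : Fin N → ℕ) (F : MvPolynomial (Fin N) ℂ),
    (d' : ℤ) = d ∧ (∀ i, (e' i : ℤ) = e i) ∧ Good τ d' e' F

theorem Eff.flip {N : ℕ} {τ : Fin N → ℂ} (hτ : Function.Injective τ) {d : ℤ} {e : Fin N → ℤ}
    (h : Eff τ d e) {j k : Fin N} (hjk : j ≠ k) :
    Eff τ (∑ i, e i - e j - e k - d)
      (fun i => if i = j ∨ i = k then ∑ i, e i - 2 * d - e i else e i) := by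
  obtain ⟨d', e', F, hd, he, hF⟩ := h
  have hne := flip_ne τ hτ d' e' F hF hjk
  have hhom := flip_hom τ d' e' F hF hjk
  have h1 := flip_degree τ hτ d' e' F hF hjk hne
  have h2 := flip_degree τ hτ d' e' F hF hjk.symm (by rwa [flipA_symm, flipB_symm])
  rw [flipA_symm τ k j, flipB_symm τ k j] at h2
  have hs := sum_split e' hjk
  have hsum : ∑ i, e i = ((∑ i, e' i : ℕ) : ℤ) := by
    push_cast; exact Finset.sum_congr rfl fun i _ => (he i).symm
  obtain ⟨α, hα⟩ : ∃ α ∈ F.support, α j = 0 ∧ α k = 0 := by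
    by_contra! hcon
    apply hne
    unfold MH
    refine Finset.sum_eq_zero fun α hα => ?_
    have : ∃ i, α i ≠ 0 ∧ flipA τ j k i = 0 := by
      by_cases hj : α j = 0
      · exact ⟨k, hcon α hα hj, by simp [flipA]⟩
      · exact ⟨j, hj, by simp [flipA]⟩
    obtain ⟨i, hi, hA⟩ := this
    rw [Finset.prod_eq_zero (Finset.mem_univ i) (by simp [hA, hi]), mul_zero]
  have hd1 : d' ≤ ∑ i, (if i = j ∨ i = k then 0 else e' i) := by
    have h3 := sum_of_hom hF.2.1 hα.1
    rw [sum_split (fun i => α i) hjk, hα.2.1, hα.2.2] at h3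
    rw [← h3]
    simp only [add_zero]
    refine Finset.sum_le_sum fun i _ => ?_
    have := degreeOf_le_iff.1 (hF.2.2.1 i) α hα.1
    split_ifs <;> simp [this]
  refine ⟨∑ i, (if i = j ∨ i = k then 0 else e' i) - d',
    fun i => if i = j ∨ i = k then ∑ i, e' i - 2 * d' - e' i else e' i,
    MH F e' (flipA τ j k) (flipB τ j k), ?_, ?_, hne, hhom, ?_, ?_⟩
  · rw [hsum, ← hd, ← he, ← he, Nat.cast_sub hd1]
    have := congrArg (Nat.cast (R := ℤ)) hs
    push_cast at this ⊢
    linarith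
  · intro i
    by_cases hij : i = j
    · subst hij
      simp only [true_or, if_true]
      rw [hsum, ← he, ← hd]
      omega
    by_cases hik : i = k
    · subst hik
      simp only [or_true, if_true]
      rw [hsum, ← he, ← hd]
      omega
    simp [hij, hik, he]
  · intro i
    by_cases hij : i = j
    · subst hij
      simp only [true_or, if_true]
      omega
    by_cases hik : i = k
    · subst hik
      simp only [or_true, if_true]
      omega
    simp only [hij, hik, or_self, if_false]
    refine degreeOf_MH_le _ _ _ _ _ _ fun α hα => Or.inr ?_
    have hle : ∀ i, α i ≤ e' i := fun i => degreeOf_le_iff.1 (hF.2.2.1 i) α hα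
    calc _ ≤ ∑ l, (if l = i then e' i else 0) := by
          refine Finset.sum_le_sum fun l _ => ?_
          have hA : (flipA τ j k l).degreeOf i = 0 := by
            unfold flipA; split_ifs <;> simp only [degreeOf_zero, degreeOf_C]
          have hB : (flipB τ j k l).degreeOf i ≤ if l = i then 1 else 0 := by
            unfold flipB; split_ifs with h1 h2 h2
            · simp
            · simp
            · refine (degreeOf_ell_le _ _ _ _ _).trans ?_
              split_ifs <;> simp
            · refine (degreeOf_ell_le _ _ _ _ _).trans ?_
              simp [hij, hik, Ne.symm h2]
          rw [hA, mul_zero, zero_add]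
          refine (Nat.mul_le_mul_left _ hB).trans ?_
          split_ifs with h
          · subst h; omega
          · simp
      _ = _ := by simp
  · intro a b c
    have hBt : ∀ i, eval (fun i => c i + a + b * τ i) (flipB τ j k i) = eval c (flipB τ j k i) := by
      intro i; unfold flipB; split_ifs
      · simp
      · exact ell_transl τ hτ hjk i a b c
    have hAt : ∀ i, eval (fun i => c i + a + b * τ i) (flipA τ j k i) = eval c (flipA τ j k i) := by
      intro i; unfold flipA; split_ifs
      · simp
      · rw [eval_C, eval_C]
    simp only [MH, map_sum, map_mul, map_prod, map_pow, hAt, hBt, eval_C]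

end BigCone

namespace BigCone
open MvPolynomial Finset

/-- The (cone over the) parity polytope. -/
def InCone {N : ℕ} (κ : ℤ) (e : Fin N → ℤ) : Prop :=
  (∀ i, 0 ≤ e i ∧ e i ≤ κ) ∧
    ∀ P : Finset (Fin N), Even P.card → κ ≤ ∑ i, (if i ∈ P then κ - e i else e i)

lemma sum_flip {N : ℕ} (κ : ℤ) (e : Fin N → ℤ) {j k : Fin N} (hjk : j ≠ k) :
    ∑ i, (if i = j ∨ i = k then κ - e i else e i) = ∑ i, e i + 2 * κ - 2 * e j - 2 * e k := by
  have h : ∀ i, (if i = j ∨ i = k then κ - e i else e i) = e i +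
      (if i = j then κ - 2 * e j else 0) + (if i = k then κ - 2 * e k else 0) := by
    intro i
    by_cases h1 : i = j
    · subst h1; simp [hjk]; ring
    by_cases h2 : i = k
    · subst h2; simp [h1]; ring
    simp [h1, h2]
  rw [Finset.sum_congr rfl fun i _ => h i, Finset.sum_add_distrib, Finset.sum_add_distrib]
  simp; ring

theorem Eff.flip' {N : ℕ} {τ : Fin N → ℂ} (hτ : Function.Injective τ) {d κ : ℤ} {e : Fin N → ℤ}
    (hκ : ∑ i, e i = κ + 2 * d)
    (h : Eff τ d e) {j k : Fin N} (hjk : j ≠ k) :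
    Eff τ (d + κ - e j - e k) (fun i => if i = j ∨ i = k then κ - e i else e i) := by
  have := h.flip hτ hjk
  rw [hκ] at this
  convert this using 1
  · ring
  · funext i; split_ifs <;> ring

lemma Eff.nonneg {N : ℕ} {τ : Fin N → ℂ} {d : ℤ} {e : Fin N → ℤ} (h : Eff τ d e) :
    0 ≤ d ∧ ∀ i, 0 ≤ e i := by
  obtain ⟨d', e', F, hd, he, -⟩ := h
  exact ⟨by omega, fun i => by rw [← he]; positivity⟩

theorem Eff.parity {N : ℕ} {τ : Fin N → ℂ} (hτ : Function.Injective τ) (κ : ℤ) :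
    ∀ (r : ℕ) (P : Finset (Fin N)), P.card = r + r → ∀ (d : ℤ) (e : Fin N → ℤ),
    ∑ i, e i = κ + 2 * d → Eff τ d e → κ ≤ ∑ i, (if i ∈ P then κ - e i else e i) := by
  intro r
  induction r with
  | zero =>
    intro P hP d e hκ h
    obtain rfl : P = ∅ := Finset.card_eq_zero.1 hP
    simp only [Finset.notMem_empty, if_false]
    have := h.nonneg.1
    omega
  | succ r ih =>
    intro P hP d e hκ h
    obtain ⟨j, hj, k, hk, hjk⟩ := Finset.one_lt_card.1 (show 1 < P.card by omega)
    have hcard : ((P.erase j).erase k).card = r + r := by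
      rw [Finset.card_erase_of_mem (by simp [hk, hjk.symm]), Finset.card_erase_of_mem hj]
      omega
    have := ih _ hcard _ _ (by rw [sum_flip _ _ hjk, hκ]; ring) (h.flip' hτ hκ hjk)
    refine this.trans_eq (Finset.sum_congr rfl fun i _ => ?_)
    by_cases h1 : i = j
    · subst h1; simp [hj]
    by_cases h2 : i = k
    · subst h2; simp [hk]
    simp [h1, h2]

theorem Eff.inCone {N : ℕ} {τ : Fin N → ℂ} (hτ : Function.Injective τ) (hN : 2 ≤ N) {d κ : ℤ}
    {e : Fin N → ℤ} (hκ : ∑ i, e i = κ + 2 * d) (h : Eff τ d e) : InCone κ e := by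
  refine ⟨fun i => ⟨h.nonneg.2 i, ?_⟩, fun P ⟨r, hr⟩ => Eff.parity hτ κ r P hr d e hκ h⟩
  have : Nontrivial (Fin N) := Fin.nontrivial_iff_two_le.2 hN
  obtain ⟨k, hk⟩ := exists_ne i
  have := (h.flip' hτ hκ hk.symm).nonneg.2 i
  simp at this
  omega

lemma InCone.flip {N : ℕ} {κ : ℤ} {e : Fin N → ℤ} (h : InCone κ e) {j k : Fin N} (hjk : j ≠ k) :
    InCone κ (fun i => if i = j ∨ i = k then κ - e i else e i) := by
  refine ⟨fun i => ?_, fun P hP => ?_⟩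
  · have := h.1 i
    dsimp only
    split_ifs <;> constructor <;> omega
  · have hev : Even (symmDiff P {j, k}).card := by
      have h1 := Finset.card_sdiff_add_card_inter P {j, k}
      have h2 := Finset.card_sdiff_add_card_inter {j, k} P
      rw [Finset.card_pair hjk, Finset.inter_comm] at h2
      have h3 : (symmDiff P {j, k}).card = (P \ {j, k}).card + ({j, k} \ P).card :=
        Finset.card_union_of_disjoint disjoint_sdiff_sdiff
      obtain ⟨r, hr⟩ := hP
      rw [h3]
      exact ⟨r + 1 - (P ∩ {j, k}).card, by omega⟩
    refine (h.2 _ hev).trans_eq (Finset.sum_congr rfl fun i _ => ?_)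
    by_cases h1 : i ∈ P <;> by_cases h2 : i = j ∨ i = k <;>
      simp [Finset.mem_symmDiff, h1, h2]

lemma Eff.mono {N : ℕ} {τ : Fin N → ℂ} {d : ℤ} {e e' : Fin N → ℤ} (h : Eff τ d e)
    (hle : ∀ i, e i ≤ e' i) : Eff τ d e' := by
  have h0 := h.nonneg.2
  obtain ⟨d', f, F, hd, he, hF0, hF1, hF2, hF3⟩ := h
  refine ⟨d', fun i => (e' i).toNat, F, hd, fun i => ?_, hF0, hF1, fun i => ?_, hF3⟩
  · have := h0 i; have := hle i; simp; omega
  · have := hF2 i; have := he i; have := hle i; dsimp only; omega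

lemma pair_sum {N : ℕ} {κ : ℤ} {e : Fin N → ℤ} (h : ∀ i j, i ≠ j → e i + e j ≤ κ) :
    ∀ (r : ℕ) (P : Finset (Fin N)), P.card = r + r → ∑ i ∈ P, e i ≤ r * κ := by
  intro r
  induction r with
  | zero =>
    intro P hP
    obtain rfl : P = ∅ := Finset.card_eq_zero.1 hP
    simp
  | succ r ih =>
    intro P hP
    obtain ⟨j, hj, k, hk, hjk⟩ := Finset.one_lt_card.1 (show 1 < P.card by omega)
    have hk' : k ∈ P.erase j := by simp [hk, hjk.symm]
    have hcard : ((P.erase j).erase k).card = r + r := by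
      rw [Finset.card_erase_of_mem hk', Finset.card_erase_of_mem hj]
      omega
    have := ih _ hcard
    rw [← Finset.add_sum_erase _ _ hj, ← Finset.add_sum_erase _ _ hk']
    have := h j k hjk
    push_cast
    linarith

lemma flip_sum_eq {N : ℕ} (κ : ℤ) (e : Fin N → ℤ) (P : Finset (Fin N)) :
    ∑ i, (if i ∈ P then κ - e i else e i) = P.card * κ + ∑ i, e i - 2 * ∑ i ∈ P, e i := by
  have : ∀ i, (if i ∈ P then κ - e i else e i) = e i + (if i ∈ P then κ - 2 * e i else 0) := by
    intro i; split_ifs <;> ring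
  rw [Finset.sum_congr rfl fun i _ => this i, Finset.sum_add_distrib, Finset.sum_ite_mem,
    Finset.univ_inter, Finset.sum_sub_distrib, ← Finset.mul_sum]
  simp; ring

theorem InCone.eff {N : ℕ} {τ : Fin N → ℂ} (hτ : Function.Injective τ) (hN : 2 ≤ N) :
    ∀ (κ' d' : ℕ) (κ d : ℤ), κ = κ' → d = d' → ∀ (e : Fin N → ℤ), ∑ i, e i = κ + 2 * d →
      InCone κ e → Eff τ d e := by
  intro κ'
  induction κ' with
  | zero =>
    intro d' κ d hκ hd e hs hc
    have h0 : ∀ i, e i = 0 := by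
      intro i; have := hc.1 i; push_cast at hκ; omega
    have hd0 : d = 0 := by
      simp [h0] at hs; push_cast at hκ; omega
    refine ⟨0, fun _ => 0, 1, by simp [hd0], by simp [h0], one_ne_zero, isHomogeneous_one _ _,
      by simp, by simp⟩
  | succ κ' ih =>
    intro d'
    induction d' using Nat.strong_induction_on with
    | _ d' ihd =>
    intro κ d hκ hd e hs hc
    by_cases hred : ∀ i j, i ≠ j → e i + e j ≤ κ
    swap
    · push Not at hred
      obtain ⟨j, k, hjk, hlt⟩ := hred
      have hc' := hc.flip hjk
      have hs' := sum_flip κ e hjk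
      have hnn := hc'.2 ∅ (by simp)
      simp only [Finset.notMem_empty, if_false] at hnn
      have hd'' : d + κ - e j - e k = ((d + κ - e j - e k).toNat : ℤ) := by omega
      have := ihd (d + κ - e j - e k).toNat (by omega) κ (d + κ - e j - e k) hκ hd'' _
        (by rw [hs', hs]; ring) hc'
      have h2 := this.flip' hτ (κ := κ) (by rw [hs', hs]; ring) hjk
      convert h2 using 1
      · simp; ring
      · funext i
        by_cases h : i = j ∨ i = k <;> simp [h]
    have : Nonempty (Fin N) := ⟨⟨0, by omega⟩⟩
    obtain ⟨i₁, hi₁⟩ := Finite.exists_max e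
    have hκ1 : 1 ≤ κ := by omega
    have he1 : 1 ≤ e i₁ := by
      by_contra hcon
      have : ∑ i, e i ≤ 0 := Finset.sum_nonpos fun i _ => by have := hi₁ i; omega
      omega
    have hs' : ∑ i, (e i - if i = i₁ then 1 else 0) = ∑ i, e i - 1 := by
      rw [Finset.sum_sub_distrib]; simp
    have hin : InCone (κ - 1) (fun i => e i - if i = i₁ then 1 else 0) := by
      refine ⟨fun i => ?_, fun P hP => ?_⟩
      · have h1 := hc.1 i
        by_cases h : i = i₁
        · subst h; simp; omega
        · have := hi₁ i
          have := hred i i₁ h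
          simp [h]; omega
      · obtain ⟨r, hr⟩ := hP
        rw [flip_sum_eq, hs', Finset.sum_sub_distrib, Finset.sum_ite_eq']
        have hps := pair_sum hred r P hr
        have hcard : (P.card : ℤ) = r + r := by exact_mod_cast hr
        rw [hcard]
        have hQ : ∑ i ∈ P, e i ≤ ∑ i, e i := 
          Finset.sum_le_sum_of_subset_of_nonneg (Finset.subset_univ _) fun i _ _ => (hc.1 i).1
        rcases r with _ | _ | r
        · obtain rfl : P = ∅ := Finset.card_eq_zero.1 hr
          simp; omega
        · push_cast at hps ⊢
          by_cases hP1 : i₁ ∈ P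
          · simp only [hP1, if_true]; linarith
          · simp only [hP1, if_false]
            -- parity
            by_contra hcon
            have hsub : ∑ i ∈ P, e i + e i₁ ≤ ∑ i, e i := by
              rw [add_comm, ← Finset.sum_insert hP1]
              exact Finset.sum_le_sum_of_subset_of_nonneg (Finset.subset_univ _)
                fun i _ _ => (hc.1 i).1
            omega
        · push_cast at hps ⊢
          have hr0 : (0 : ℤ) ≤ r := by positivity
          have hones : κ = 1 → ∑ i ∈ P, e i = if i₁ ∈ P then e i₁ else 0 := by
            rintro rfl
            rw [← Finset.sum_ite_eq' P i₁ e]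
            refine Finset.sum_congr rfl fun i _ => ?_
            split_ifs with h
            · rfl
            · have := hred i i₁ h
              have := (hc.1 i).1
              omega
          by_cases hP1 : i₁ ∈ P
          · simp only [hP1, if_true]
            rcases (show κ = 1 ∨ κ = 2 ∨ 3 ≤ κ by omega) with rfl | rfl | h3
            · have h1 := hones rfl
              have h2 := hc.1 i₁
              simp only [hP1, if_true] at h1
              omega
            · omega
            · nlinarith
          · simp only [hP1, if_false]
            have hsub : ∑ i ∈ P, e i + e i₁ ≤ ∑ i, e i := by
              rw [add_comm, ← Finset.sum_insert hP1]
              exact Finset.sum_le_sum_of_subset_of_nonneg (Finset.subset_univ _)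
                fun i _ _ => (hc.1 i).1
            rcases (show κ = 1 ∨ κ = 2 ∨ 3 ≤ κ by omega) with rfl | rfl | h3
            · have h1 := hones rfl
              simp only [hP1, if_false] at h1
              omega
            · omega
            · nlinarith
    have := ih d' (κ - 1) d (by push_cast at hκ; omega) hd _ (by rw [hs', hs]; ring) hin
    exact this.mono fun i => by split_ifs <;> omega

end BigCone

namespace BigCone
open MvPolynomial Finset

lemma eval_aeval {n N : ℕ} (x : Fin n → ℂ) (g : Fin N → MvPolynomial (Fin n) ℂ)
    (f : MvPolynomial (Fin N) ℂ) : eval x (aeval g f) = eval (fun j => eval x (g j)) f := by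
  induction f using MvPolynomial.induction_on with
  | C a => simp
  | add f g hf hg => rw [map_add, map_add, map_add, hf, hg]
  | mul_X f i hf => rw [map_mul, map_mul, map_mul, hf, aeval_X, eval_X]

/-- translation of a polynomial to the point `p` -/
noncomputable def shift {n : ℕ} (p : Fin n → ℂ) :
    MvPolynomial (Fin n) ℂ →ₐ[ℂ] MvPolynomial (Fin n) ℂ :=
  aeval (fun k => X k + C (p k))

lemma eval_shift {n : ℕ} (p x : Fin n → ℂ) (f : MvPolynomial (Fin n) ℂ) :
    eval x (shift p f) = eval (fun k => x k + p k) f := by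
  unfold shift
  rw [eval_aeval]
  simp

lemma pderiv_shift {n : ℕ} (p : Fin n → ℂ) (i : Fin n) (f : MvPolynomial (Fin n) ℂ) :
    pderiv i (shift p f) = shift p (pderiv i f) := by
  induction f using MvPolynomial.induction_on with
  | C a => simp [shift]
  | add f g hf hg => simp [hf, hg]
  | mul_X f j hf =>
    rw [map_mul, Derivation.leibniz, hf, Derivation.leibniz]
    have : pderiv i (shift p (X j)) = shift p (pderiv i (X j)) := by
      by_cases h : i = j
      · subst h; simp [shift]
      · simp [shift, pderiv_X_of_ne (Ne.symm h)]
    rw [this]; simp [smul_eq_mul]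

lemma pderiv_pow_shift {n : ℕ} (p : Fin n → ℂ) (i : Fin n) (r : ℕ) (f : MvPolynomial (Fin n) ℂ) :
    ((pderiv i).toLinearMap ^ r) (shift p f) = shift p (((pderiv i).toLinearMap ^ r) f) := by
  induction r with
  | zero => simp
  | succ r ih =>
    rw [pow_succ', Module.End.mul_apply, ih, Module.End.mul_apply]
    exact pderiv_shift p i _

/-- the derivative along a list of variables -/
noncomputable def pdl {n : ℕ} (α : Fin n → ℕ) (l : List (Fin n)) :
    MvPolynomial (Fin n) ℂ →ₗ[ℂ] MvPolynomial (Fin n) ℂ :=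
  l.foldl (fun L i => ((MvPolynomial.pderiv i).toLinearMap ^ α i) ∘ₗ L) LinearMap.id

lemma pdl_append {n : ℕ} (α : Fin n → ℕ) (l : List (Fin n)) (i : Fin n)
    (f : MvPolynomial (Fin n) ℂ) :
    pdl α (l ++ [i]) f = ((pderiv i).toLinearMap ^ α i) (pdl α l f) := by
  unfold pdl
  rw [List.foldl_append]
  rfl

lemma foldl_shift {n : ℕ} (p : Fin n → ℂ) (α : Fin n → ℕ) (l : List (Fin n))
    (f : MvPolynomial (Fin n) ℂ) :
    pdl α l (shift p f) = shift p (pdl α l f) := by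
  induction l using List.reverseRecOn with
  | nil => rfl
  | append_singleton l i ih =>
    rw [pdl_append, pdl_append, ih, pderiv_pow_shift]

lemma coeff_pderiv_pow {n : ℕ} (i : Fin n) (r : ℕ) (β : Fin n →₀ ℕ) :
    ∃ c : ℂ, c ≠ 0 ∧ ∀ f : MvPolynomial (Fin n) ℂ,
      coeff β (((pderiv i).toLinearMap ^ r) f) = c * coeff (β + Finsupp.single i r) f := by
  induction r generalizing β with
  | zero => exact ⟨1, one_ne_zero, by simp⟩
  | succ r ih =>
    obtain ⟨c, hc, h⟩ := ih (β + Finsupp.single i 1)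
    refine ⟨c * (β i + 1), mul_ne_zero hc (Nat.cast_add_one_ne_zero (β i)), fun f => ?_⟩
    rw [pow_succ', Module.End.mul_apply]
    have := coeff_pderiv (i := i) (((pderiv i).toLinearMap ^ r) f) β
    rw [h f, add_assoc, ← Finsupp.single_add, add_comm 1 r] at this
    rw [show c * ((β i : ℂ) + 1) * coeff (β + Finsupp.single i (r + 1)) f =
      c * coeff (β + Finsupp.single i (r + 1)) f * (β i + 1) by ring, ← this]
    rfl

lemma coeff_foldl {n : ℕ} (α : Fin n → ℕ) (l : List (Fin n)) (β : Fin n →₀ ℕ) :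
    ∃ c : ℂ, c ≠ 0 ∧ ∀ f : MvPolynomial (Fin n) ℂ,
      coeff β (pdl α l f) =
        c * coeff (β + (l.map fun i => Finsupp.single i (α i)).sum) f := by
  induction l using List.reverseRecOn generalizing β with
  | nil => exact ⟨1, one_ne_zero, by simp [pdl]⟩
  | append_singleton l i ih =>
    obtain ⟨c, hc, h⟩ := coeff_pderiv_pow i (α i) β
    obtain ⟨c', hc', h'⟩ := ih (β + Finsupp.single i (α i))
    refine ⟨c * c', mul_ne_zero hc hc', fun f => ?_⟩
    rw [pdl_append, h, h', List.map_append, List.sum_append]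
    simp only [List.map_cons, List.map_nil, List.sum_cons, List.sum_nil, add_zero]
    rw [add_assoc, add_comm (Finsupp.single i (α i)), mul_assoc]

lemma eval_pd {n : ℕ} (p : Fin n → ℂ) (α : Fin n → ℕ) :
    ∃ c : ℂ, c ≠ 0 ∧ ∀ f : MvPolynomial (Fin n) ℂ,
      aeval p (pd α f) = c * coeff (Finsupp.equivFunOnFinite.symm α) (shift p f) := by
  obtain ⟨c, hc, h⟩ := coeff_foldl α (List.finRange n) 0
  refine ⟨c, hc, fun f => ?_⟩
  have h1 := h (shift p f)
  have h3 : (0 + ((List.finRange n).map fun i => Finsupp.single i (α i)).sum) =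
      Finsupp.equivFunOnFinite.symm α := by
    rw [zero_add, ← List.ofFn_eq_map, List.sum_ofFn]
    ext j
    simp [Finsupp.single_apply]
  rw [foldl_shift, h3] at h1
  rw [← h1, ← constantCoeff_eq]
  have h4 : ∀ g : MvPolynomial (Fin n) ℂ, aeval p g = constantCoeff (shift p g) := by
    intro g
    have := eval_shift p 0 g
    rw [aeval_eq_eval, ← eval_zero']
    simpa [Pi.zero_def] using this.symm
  rw [h4]
  rfl

lemma mem_Lsys {n s d : ℕ} (m : Fin s → ℕ) (p : Fin s → Fin n → ℂ) (f : MvPolynomial (Fin n) ℂ) :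
    f ∈ Lsys ℂ n s d m p ↔ f.totalDegree ≤ d ∧
      ∀ i (β : Fin n →₀ ℕ), ∑ j, β j < m i → coeff β (shift (p i) f) = 0 := by
  unfold Lsys
  simp only [Submodule.mem_inf, mem_restrictTotalDegree, Submodule.mem_iInf, LinearMap.mem_ker,
    LinearMap.comp_apply]
  refine and_congr_right fun _ => forall_congr' fun i => ⟨fun h β hβ => ?_, fun h α hα => ?_⟩
  · obtain ⟨c, hc, h1⟩ := eval_pd (p i) (β : Fin n → ℕ)
    have h2 := h β hβ
    have h3 := h1 f
    erw [h2] at h3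
    rcases mul_eq_zero.1 h3.symm with h | h
    · exact absurd h hc
    · convert h using 2
      ext; simp
  · obtain ⟨c, hc, h1⟩ := eval_pd (p i) α
    have h2 := h (Finsupp.equivFunOnFinite.symm α) (by simpa using hα)
    have h3 := h1 f
    rw [h2, mul_zero] at h3
    exact h3

/-- linear form with coefficient vector `a` -/
noncomputable def lin {N : ℕ} (a : Fin N → ℂ) : MvPolynomial (Fin N) ℂ := ∑ j, C (a j) * X j

lemma eval_lin {N : ℕ} (a c : Fin N → ℂ) : eval c (lin a) = ∑ j, a j * c j := by simp [lin]

lemma hom_lin {N : ℕ} (a : Fin N → ℂ) : (lin a).IsHomogeneous 1 :=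
  IsHomogeneous.sum _ _ _ fun j _ => by
    simpa using (isHomogeneous_C (Fin N) (a j)).mul (isHomogeneous_X ℂ j)

lemma degreeOf_lin {N : ℕ} (a : Fin N → ℂ) (i : Fin N) :
    (lin a).degreeOf i ≤ if a i = 0 then 0 else 1 := by
  unfold lin
  refine (degreeOf_sum_le _ _ _).trans (Finset.sup_le fun j _ => ?_)
  by_cases hj : i = j
  · subst hj
    by_cases h : a i = 0
    · simp [h]
    · simp only [h, if_false]
      refine (degreeOf_C_mul_le _ _ _).trans (by simp)
  · refine (degreeOf_C_mul_le _ _ _).trans ?_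
    rw [degreeOf_X_of_ne hj]; simp

/-- homogeneous substitution -/
noncomputable def HS {n N : ℕ} (f : MvPolynomial (Fin n) ℂ) (d : ℕ)
    (A : Fin n → MvPolynomial (Fin N) ℂ) (B : MvPolynomial (Fin N) ℂ) : MvPolynomial (Fin N) ℂ :=
  ∑ α ∈ f.support, C (coeff α f) * (B ^ (d - ∑ k, α k) * ∏ k, A k ^ α k)

lemma sum_le_of_mem {n d : ℕ} {f : MvPolynomial (Fin n) ℂ} (hf : f.totalDegree ≤ d)
    {α : Fin n →₀ ℕ} (hα : α ∈ f.support) : ∑ k, α k ≤ d := by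
  have := (le_totalDegree hα).trans hf
  rwa [Finsupp.sum_fintype _ _ (by simp)] at this

lemma eval_HS {n N d : ℕ} (f : MvPolynomial (Fin n) ℂ) (hf : f.totalDegree ≤ d)
    (A : Fin n → MvPolynomial (Fin N) ℂ) (B : MvPolynomial (Fin N) ℂ) (c : Fin N → ℂ)
    (hB : eval c B ≠ 0) :
    eval c (HS f d A B) = eval c B ^ d * eval (fun k => eval c (A k) / eval c B) f := by
  rw [HS, map_sum, eval_eq' _ f, Finset.mul_sum]
  refine Finset.sum_congr rfl fun α hα => ?_
  simp only [map_mul, eval_C, map_prod, map_pow]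
  rw [mul_left_comm (eval c B ^ d)]
  congr 1
  have h1 := sum_le_of_mem hf hα
  rw [Finset.prod_congr rfl fun k _ => div_pow _ _ _, Finset.prod_div_distrib, Finset.prod_pow_eq_pow_sum, pow_sub₀ _ hB h1]
  ring

lemma totalDegree_shift {n : ℕ} (p : Fin n → ℂ) (f : MvPolynomial (Fin n) ℂ) {d : ℕ}
    (hf : f.totalDegree ≤ d) : (shift p f).totalDegree ≤ d := by
  unfold shift
  rw [aeval_def, eval₂_eq']
  refine totalDegree_finsetSum_le fun α hα => ?_
  refine (totalDegree_mul _ _).trans ?_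
  have h1 := sum_le_of_mem hf hα
  have h2 : (∏ i, (X i + C (p i) : MvPolynomial (Fin n) ℂ) ^ α i).totalDegree ≤ ∑ i, α i := by
    refine (totalDegree_finsetProd _ _).trans (Finset.sum_le_sum fun i _ => ?_)
    refine (totalDegree_pow _ _).trans ?_
    have : (X i + C (p i) : MvPolynomial (Fin n) ℂ).totalDegree ≤ 1 :=
      (totalDegree_add _ _).trans (by simp)
    nlinarith
  simp only [algebraMap_eq, totalDegree_C, zero_add]
  exact h2.trans h1

/-- Data connecting the invariant-theoretic model with points of affine space. -/
structure Geo (n N : ℕ) (τ : Fin N → ℂ) where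
  a : Fin n → Fin N → ℂ
  b : Fin N → ℂ
  s0 : Fin N → ℂ
  s : Fin n → Fin N → ℂ
  ha1 : ∀ k, ∑ j, a k j = 0
  haτ : ∀ k, ∑ j, a k j * τ j = 0
  hb1 : ∑ j, b j = 0
  hbτ : ∑ j, b j * τ j = 0
  hb0 : ∀ i, b i ≠ 0
  sec_b : ∀ x : Fin n → ℂ, ∑ j, b j * (s0 j + ∑ k, s k j * x k) = 1
  sec_a : ∀ (x : Fin n → ℂ) k, ∑ j, a k j * (s0 j + ∑ k, s k j * x k) = x k
  inv : ∀ c : Fin N → ℂ, ∃ A B : ℂ, ∀ j,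
    s0 j * ∑ l, b l * c l + ∑ k, s k j * ∑ l, a k l * c l = c j + A + B * τ j

/-- the points -/
noncomputable def Geo.pt {n N : ℕ} {τ : Fin N → ℂ} (g : Geo n N τ) (i : Fin N) (k : Fin n) : ℂ :=
  g.a k i / g.b i

lemma lin_transl {N : ℕ} {τ a : Fin N → ℂ} (h1 : ∑ j, a j = 0) (h2 : ∑ j, a j * τ j = 0)
    (A B : ℂ) (c : Fin N → ℂ) : eval (fun i => c i + A + B * τ i) (lin a) = eval c (lin a) := by
  rw [eval_lin, eval_lin]
  have : ∀ j, a j * (c j + A + B * τ j) = a j * c j + A * a j + B * (a j * τ j) := fun j => by ring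
  simp_rw [this]
  rw [Finset.sum_add_distrib, Finset.sum_add_distrib, ← Finset.mul_sum, ← Finset.mul_sum, h1, h2]
  ring

theorem Geo.good_of_mem {n N : ℕ} {τ : Fin N → ℂ} (g : Geo n N τ) {d : ℕ}
    {m : Fin N → ℕ}
    {f : MvPolynomial (Fin n) ℂ} (hf0 : f ≠ 0) (hf : f ∈ Lsys ℂ n N d m g.pt) :
    (∀ i, m i ≤ d) ∧ ∃ F, Good τ d (fun i => d - m i) F := by
  rw [mem_Lsys] at hf
  obtain ⟨hfd, hfm⟩ := hf
  have hshift : ∀ q, shift q f ≠ 0 := by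
    intro q h
    obtain ⟨x, hx⟩ := exists_eval_ne hf0
    have := eval_shift q (fun k => x k - q k) f
    rw [h] at this
    simp at this
    exact hx this.symm
  have hmle : ∀ i, ∀ α ∈ (shift (g.pt i) f).support, m i ≤ ∑ k, α k := by
    intro i α hα
    by_contra hcon
    exact (mem_support_iff.1 hα) (hfm i α (by omega))
  have hb : lin g.b ≠ 0 := by
    intro h
    have := eval_lin g.b (fun j => g.s0 j + ∑ k, g.s k j * 0)
    rw [g.sec_b, h] at this
    simp at this
  refine ⟨fun i => ?_, HS f d (fun k => lin (g.a k)) (lin g.b), ?_, ?_, fun i => ?_, ?_⟩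
  · obtain ⟨α, hα⟩ := support_nonempty.2 (hshift (g.pt i))
    exact (hmle i α hα).trans (sum_le_of_mem (totalDegree_shift _ _ hfd) hα)
  · intro h
    obtain ⟨x, hx⟩ := exists_eval_ne hf0
    have h1 : eval (fun j => g.s0 j + ∑ k, g.s k j * x k) (lin g.b) = 1 := by
      rw [eval_lin, g.sec_b]
    have := eval_HS f hfd (fun k => lin (g.a k)) (lin g.b)
      (fun j => g.s0 j + ∑ k, g.s k j * x k) (by rw [h1]; exact one_ne_zero)
    rw [h, h1] at this
    simp only [eval_lin, g.sec_a] at this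
    simp at this
    exact hx this.symm
  · unfold HS
    refine IsHomogeneous.sum _ _ _ fun α hα => ?_
    have h1 := sum_le_of_mem hfd hα
    have h2 : (∏ k, lin (g.a k) ^ α k).IsHomogeneous (∑ k, α k) :=
      IsHomogeneous.prod _ _ _ fun k _ => by simpa using (hom_lin (g.a k)).pow (α k)
    have h3 := ((hom_lin g.b).pow (d - ∑ k, α k)).mul h2
    have h4 := (isHomogeneous_C (Fin N) (coeff α f)).mul h3
    convert h4 using 1
    omega
  · have heq : HS f d (fun k => lin (g.a k)) (lin g.b) =
        HS (shift (g.pt i) f) d (fun k => lin (fun j => g.a k j - g.pt i k * g.b j)) (lin g.b) := by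
      refine eq_of_eval_off _ _ (lin g.b) hb fun c hc => ?_
      rw [eval_HS f hfd _ _ _ hc, eval_HS _ (totalDegree_shift _ _ hfd) _ _ _ hc, eval_shift]
      congr 3
      funext k
      have : eval c (lin fun j => g.a k j - g.pt i k * g.b j) =
          eval c (lin (g.a k)) - g.pt i k * eval c (lin g.b) := by
        simp only [eval_lin, sub_mul, Finset.sum_sub_distrib, Finset.mul_sum, mul_assoc]
      rw [this]
      field_simp
      ring
    rw [heq]
    unfold HS
    refine (degreeOf_sum_le _ _ _).trans (Finset.sup_le fun α hα => ?_)
    refine (degreeOf_C_mul_le _ _ _).trans ((degreeOf_mul_le _ _ _).trans ?_)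
    have h1 : (lin g.b ^ (d - ∑ k, α k)).degreeOf i ≤ d - ∑ k, α k := by
      refine (degreeOf_pow_le _ _ _).trans ?_
      have := degreeOf_lin g.b i
      rw [if_neg (g.hb0 i)] at this
      nlinarith
    have h2 : (∏ k, lin (fun j => g.a k j - g.pt i k * g.b j) ^ α k).degreeOf i = 0 := by
      refine Nat.le_zero.1 ((degreeOf_prod_le _ _ _).trans ?_)
      refine (Finset.sum_nonpos fun k _ => ?_)
      refine (degreeOf_pow_le _ _ _).trans ?_
      have h := degreeOf_lin (fun j => g.a k j - g.pt i k * g.b j) i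
      rw [if_pos (by rw [Geo.pt, div_mul_cancel₀ _ (g.hb0 i), sub_self])] at h
      rw [Nat.le_zero.1 h]; simp
    have h3 := hmle i α hα
    rw [h2]
    dsimp only
    omega
  · intro A B c
    unfold HS
    simp only [map_sum, map_mul, eval_C, map_prod, map_pow, lin_transl g.hb1 g.hbτ,
      lin_transl (g.ha1 _) (g.haτ _)]

theorem Geo.mem_of_good {n N : ℕ} {τ : Fin N → ℂ} (g : Geo n N τ) {d : ℕ} {e m : Fin N → ℕ}
    (hem : ∀ i, e i + m i ≤ d)
    {F : MvPolynomial (Fin N) ℂ} (hF : Good τ d e F) :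
    ∃ f, f ≠ 0 ∧ f ∈ Lsys ℂ n N d m g.pt := by
  obtain ⟨hF0, hFd, hFe, hFt⟩ := hF
  -- affine substitution
  have heval : ∀ (v : Fin N → ℂ) (x : Fin n → ℂ),
      eval x (aeval (fun j => C (v j) + ∑ k, C (g.s k j) * X k : Fin N → MvPolynomial (Fin n) ℂ) F)
        = eval (fun j => v j + ∑ k, g.s k j * x k) F := by
    intro v x
    rw [eval_aeval]
    simp
  refine ⟨aeval (fun j => C (g.s0 j) + ∑ k, C (g.s k j) * X k) F, ?_, ?_⟩
  · have hb : lin g.b ≠ 0 := by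
      intro h
      have := eval_lin g.b (fun j => g.s0 j + ∑ k, g.s k j * 0)
      rw [g.sec_b, h] at this
      simp at this
    obtain ⟨c, hc⟩ := exists_eval_ne (mul_ne_zero hF0 hb)
    rw [map_mul] at hc
    have hc1 := left_ne_zero_of_mul hc
    have hc2 := right_ne_zero_of_mul hc
    intro h
    have h1 := heval g.s0 (fun k => eval c (lin (g.a k)) / eval c (lin g.b))
    rw [h, map_zero] at h1
    obtain ⟨A, B, hAB⟩ := g.inv c
    have h2 := hFt A B c
    have h3 := eval_smul_hom hFd (eval c (lin g.b)) 
      (fun j => g.s0 j + ∑ k, g.s k j * (eval c (lin (g.a k)) / eval c (lin g.b)))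
    rw [← h1, mul_zero] at h3
    apply hc1
    rw [← h2, ← h3]
    congr 1
    congr 1
    funext j
    rw [← hAB j, mul_add]
    simp only [eval_lin] at hc2 ⊢
    congr 1
    · rw [mul_comm]
    · rw [Finset.mul_sum]
      refine Finset.sum_congr rfl fun k _ => ?_
      field_simp
  · rw [mem_Lsys]
    constructor
    · rw [aeval_def, eval₂_eq']
      refine totalDegree_finsetSum_le fun α hα => ?_
      refine (totalDegree_mul _ _).trans ?_
      rw [← sum_of_hom hFd hα]
      simp only [algebraMap_eq, totalDegree_C, zero_add]
      refine (totalDegree_finsetProd _ _).trans (Finset.sum_le_sum fun i _ => ?_)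
      refine (totalDegree_pow _ _).trans ?_
      have : (C (g.s0 i) + ∑ k, C (g.s k i) * X k : MvPolynomial (Fin n) ℂ).totalDegree ≤ 1 := by
        refine (totalDegree_add _ _).trans (max_le (by simp) ?_)
        refine totalDegree_finsetSum_le fun k _ => (totalDegree_mul _ _).trans (by simp)
      nlinarith
    · intro i
      have heq : shift (g.pt i) (aeval (fun j => C (g.s0 j) + ∑ k, C (g.s k j) * X k) F) =
          aeval (fun j => C (if j = i then 1 / g.b i else 0) +
            ∑ k, C (g.s k j) * X k : Fin N → MvPolynomial (Fin n) ℂ) F := by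
        apply MvPolynomial.funext
        intro x
        rw [eval_shift, heval, heval]
        obtain ⟨A, B, hAB⟩ := g.inv (fun j => if j = i then 1 / g.b i else 0)
        refine Eq.trans ?_ (hFt A B _)
        congr 1
        congr 1
        funext j
        have h := hAB j
        simp only [mul_ite, mul_zero, Finset.sum_ite_eq', Finset.mem_univ, if_true] at h
        rw [mul_one_div_cancel (g.hb0 i)] at h
        simp only [mul_add, Finset.sum_add_distrib, Geo.pt]
        simp only [mul_one_div, mul_one] at h
        linear_combination h
      rw [heq]
      have hmem : aeval (fun j => C (if j = i then 1 / g.b i else 0) +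
            ∑ k, C (g.s k j) * X k : Fin N → MvPolynomial (Fin n) ℂ) F ∈
            idealOfVars (Fin n) ℂ ^ (m i) := by
        rw [aeval_def, eval₂_eq']
        refine Ideal.sum_mem _ fun α hα => Ideal.mul_mem_left _ _ ?_
        rw [← Finset.mul_prod_erase _ _ (Finset.mem_univ i)]
        refine Ideal.mul_mem_left _ _ ?_
        have hsum := sum_of_hom hFd hα
        rw [← Finset.add_sum_erase _ _ (Finset.mem_univ i)] at hsum
        have h1 : α i ≤ e i := (degreeOf_le_iff.1 (hFe i)) α hα
        have h2 := hem i
        refine Ideal.pow_le_pow_right (show m i ≤ ∑ j ∈ Finset.univ.erase i, α j by omega) ?_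
        rw [← Finset.prod_pow_eq_pow_sum]
        refine Ideal.prod_mem_prod fun j hj => Ideal.pow_mem_pow ?_ _
        rw [if_neg (Finset.ne_of_mem_erase hj), C_0, zero_add]
        exact Ideal.sum_mem _ fun k _ => Ideal.mul_mem_left _ _ (Ideal.subset_span ⟨k, rfl⟩)
      intro β hβ
      exact (mem_pow_idealOfVars_iff' _ _).1 hmem β (by
        rwa [Finsupp.degree_eq_sum])

end BigCone

namespace BigCone
open MvPolynomial Finset

/-- parameters on the rational normal curve -/
noncomputable def tau (n : ℕ) (i : Fin (n + 3)) : ℂ := ((i : ℕ) : ℂ)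

lemma tau_inj (n : ℕ) : Function.Injective (tau n) := by
  intro i j h
  unfold tau at h
  exact Fin.ext (by exact_mod_cast h)

lemma tau_zero (n : ℕ) : tau n 0 = 0 := by simp [tau]
lemma tau_one (n : ℕ) : tau n (Fin.succ 0) = 1 := by simp [tau]
lemma tau_two (n : ℕ) : tau n (Fin.succ (Fin.succ 0)) = 2 := by
  simp only [tau, Fin.val_succ, Fin.val_zero]; norm_num
lemma tau_s (n : ℕ) (r : Fin n) : tau n r.succ.succ.succ = (r : ℕ) + 3 := by
  simp [tau]; ring

noncomputable def geo (n : ℕ) : Geo n (n + 3) (tau n) where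
  a k := Fin.cons ((k : ℕ) + 3 - 1) (Fin.cons (-((k : ℕ) + 3)) (Fin.cons 0
    (fun r : Fin n => if r = k then 1 else 0)))
  b := Fin.cons (1 + ∑ r : Fin n, (((r : ℕ) : ℂ) + 3 - 1))
    (Fin.cons (-(2 + ∑ r : Fin n, (((r : ℕ) : ℂ) + 3))) (fun _ => 1))
  s0 := Fin.cons 0 (Fin.cons 0 (Fin.cons 1 (fun _ => 0)))
  s k := Fin.cons 0 (Fin.cons 0 (Fin.cons (-1) (fun r : Fin n => if r = k then 1 else 0)))
  ha1 k := by
    simp only [Fin.sum_univ_succ (n := n + 2), Fin.sum_univ_succ (n := n + 1),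
      Fin.sum_univ_succ (n := n), Fin.cons_zero, Fin.cons_succ]
    simp
  haτ k := by
    simp only [Fin.sum_univ_succ (n := n + 2), Fin.sum_univ_succ (n := n + 1),
      Fin.sum_univ_succ (n := n), Fin.cons_zero, Fin.cons_succ, tau_zero, tau_one, tau_two, tau_s]
    simp
  hb1 := by
    simp only [Fin.sum_univ_succ (n := n + 2), Fin.sum_univ_succ (n := n + 1),
      Fin.sum_univ_succ (n := n), Fin.cons_zero, Fin.cons_succ, Finset.sum_sub_distrib]
    simp
    ring
  hbτ := by
    simp only [Fin.sum_univ_succ (n := n + 2), Fin.sum_univ_succ (n := n + 1),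
      Fin.sum_univ_succ (n := n), Fin.cons_zero, Fin.cons_succ, tau_zero, tau_one, tau_two, tau_s]
    simp
  hb0 i := by
    refine Fin.cases ?_ (fun i => Fin.cases ?_ (fun i => ?_) i) i
    · have : (1 + ∑ r : Fin n, (((r : ℕ) : ℂ) + 3 - 1)) =
          ((1 + ∑ r : Fin n, ((r : ℕ) + 2) : ℕ) : ℂ) := by
        push_cast
        congr 1
        exact Finset.sum_congr rfl fun r _ => by ring
      rw [Fin.cons_zero, this]
      exact Nat.cast_ne_zero.2 (by omega)
    · have : (2 + ∑ r : Fin n, (((r : ℕ) : ℂ) + 3)) =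
          ((2 + ∑ r : Fin n, ((r : ℕ) + 3) : ℕ) : ℂ) := by
        push_cast
        rfl
      rw [Fin.cons_succ, Fin.cons_zero, this]
      exact neg_ne_zero.2 (Nat.cast_ne_zero.2 (by omega))
    · simp
  sec_b x := by
    simp only [Fin.sum_univ_succ (n := n + 2), Fin.sum_univ_succ (n := n + 1),
      Fin.sum_univ_succ (n := n), Fin.cons_zero, Fin.cons_succ]
    simp
  sec_a x k := by
    simp only [Fin.sum_univ_succ (n := n + 2), Fin.sum_univ_succ (n := n + 1),
      Fin.sum_univ_succ (n := n), Fin.cons_zero, Fin.cons_succ]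
    simp
  inv c := by
    refine ⟨-c 0, c 0 - c (Fin.succ 0), fun j => ?_⟩
    simp only [Fin.sum_univ_succ (n := n + 2), Fin.sum_univ_succ (n := n + 1),
      Fin.sum_univ_succ (n := n), Fin.cons_zero, Fin.cons_succ]
    refine Fin.cases ?_ (fun i => Fin.cases ?_ (fun i => Fin.cases ?_ (fun i => ?_) i) i) j
    · simp [tau_zero]
    · simp only [Fin.cons_zero, Fin.cons_succ, tau_one]; simp; ring
    · simp only [Fin.cons_zero, Fin.cons_succ, tau_two]
      simp only [ite_mul, one_mul, zero_mul, Finset.sum_ite_eq', Finset.sum_ite_eq, Finset.mem_univ,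
        if_true, Finset.sum_add_distrib, Finset.sum_sub_distrib, Finset.sum_neg_distrib, neg_mul,
        sub_mul, add_mul, zero_add, Finset.sum_mul]
      ring
    · simp only [Fin.cons_zero, Fin.cons_succ, tau_s]
      simp
      ring

end BigCone

namespace BigCone
open MvPolynomial Finset

lemma kap_sum (n : ℕ) (d : ℤ) (m : Fin (n + 3) → ℤ) :
    ∑ i, (d - m i) = ((n + 1) * d - ∑ i, m i) + 2 * d := by
  rw [Finset.sum_sub_distrib]; simp; ring

/-- existence of sections in terms of the cone -/
theorem lsys_iff (n d : ℕ) (m : Fin (n + 3) → ℕ) :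
    (∃ f, f ≠ 0 ∧ f ∈ Lsys ℂ n (n + 3) d m (geo n).pt) ↔
      InCone (((n : ℤ) + 1) * d - ∑ i, (m i : ℤ)) (fun i => (d : ℤ) - m i) := by
  have hs := kap_sum n d (fun i => (m i : ℤ))
  constructor
  · rintro ⟨f, hf0, hf⟩
    obtain ⟨hmd, F, hF⟩ := (geo n).good_of_mem hf0 hf
    refine Eff.inCone (tau_inj n) (by omega) hs ⟨d, fun i => d - m i, F, rfl, fun i => ?_, hF⟩
    have := hmd i
    push_cast [this]; rfl
  · intro h
    have hκ : 0 ≤ ((n : ℤ) + 1) * d - ∑ i, (m i : ℤ) := (h.1 0).1.trans (h.1 0).2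
    obtain ⟨κ', hκ'⟩ := Int.eq_ofNat_of_zero_le hκ
    obtain ⟨d', e', F, hd, he, hF⟩ := InCone.eff (tau_inj n) (by omega) κ' d _ d hκ' rfl _ hs h
    obtain rfl : d' = d := by exact_mod_cast hd
    exact (geo n).mem_of_good (fun i => by have := he i; dsimp only at this; omega) hF

lemma flip_formula (n : ℕ) (d : ℤ) (m : Fin (n + 3) → ℤ) (P : Finset (Fin (n + 3))) (r : ℤ)
    (hr : (P.card : ℤ) = 2 * r) :
    ∑ i, (if i ∈ P then ((n + 1) * d - ∑ i, m i) - (d - m i) else d - m i) =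
      ((n + 1) * d - ∑ i, m i) +
        2 * ((r * (n - 1) + 1) * d - (r - 1) * ∑ i, m i - ∑ i ∈ Pᶜ, m i) := by
  rw [flip_sum_eq _ (fun i => d - m i), kap_sum, Finset.sum_sub_distrib, Finset.sum_const,
    nsmul_eq_mul, hr, ← Finset.sum_add_sum_compl P]
  ring

/-- the strict version of the cone -/
def SCone {N : ℕ} (κ : ℤ) (e : Fin N → ℤ) : Prop :=
  (∀ i, 0 < e i ∧ e i < κ) ∧
    ∀ P : Finset (Fin N), Even P.card → κ < ∑ i, (if i ∈ P then κ - e i else e i)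

theorem cond_iff (n d : ℕ) (m : Fin (n + 3) → ℕ) :
    SCone (((n : ℤ) + 1) * d - ∑ i, (m i : ℤ)) (fun i => (d : ℤ) - m i) ↔
    (0 < d ∧ (∀ i, m i < d) ∧
            (∀ I : Finset (Fin (n + 3)), (I.card = n + 1 ∨ I.card = n + 2) →
              (∑ i ∈ I, m i) < n * d) ∧
            (∀ (t : ℕ), 1 ≤ t → ∀ I : Finset (Fin (n + 3)),
              (I.card : ℤ) = (n : ℤ) - 2 * t + 1 →
              (t : ℤ) * (∑ i, (m i : ℤ)) + ∑ i ∈ I, (m i : ℤ) <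
                (((n : ℤ) + 1) * t + (I.card : ℤ) - 1) * d)) := by
  have hff := flip_formula n d (fun i => (m i : ℤ))
  have hcomp : ∀ P : Finset (Fin (n + 3)), P.card + Pᶜ.card = n + 3 := fun P => by
    rw [Finset.card_add_card_compl]; simp
  have hsplit : ∀ j, ∑ i, (m i : ℤ) = m j + ∑ i ∈ {j}ᶜ, (m i : ℤ) := fun j => by
    rw [← Finset.sum_add_sum_compl {j}]; simp
  constructor
  · rintro ⟨h1, h2⟩
    refine ⟨?_, fun i => ?_, fun I hI => ?_, fun t ht I hI => ?_⟩
    · have := h1 0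
      dsimp only at this
      omega
    · have := h1 i
      dsimp only at this
      omega
    · rcases hI with hI | hI
      · have hc := hcomp I
        have h3 := h2 Iᶜ ⟨1, by omega⟩
        rw [hff Iᶜ 1 (by omega), compl_compl] at h3
        have : ((∑ i ∈ I, m i : ℕ) : ℤ) < ((n * d : ℕ) : ℤ) := by
          push_cast
          linarith
        exact_mod_cast this
      · have hc := hcomp I
        obtain ⟨j, hj⟩ := Finset.card_eq_one.1 (show Iᶜ.card = 1 by omega)
        have h3 := (h1 j).2
        rw [hsplit j, ← hj, compl_compl] at h3
        have : ((∑ i ∈ I, m i : ℕ) : ℤ) < ((n * d : ℕ) : ℤ) := by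
          push_cast
          linarith
        exact_mod_cast this
    · have hc := hcomp I
      have h3 := h2 Iᶜ ⟨t + 1, by omega⟩
      rw [hff Iᶜ (t + 1) (by omega), compl_compl] at h3
      rw [hI]
      linarith
  · rintro ⟨h1, h2, h3, h4⟩
    refine ⟨fun i => ⟨?_, ?_⟩, fun P hP => ?_⟩
    · have := h2 i
      dsimp only
      omega
    · have hc := hcomp {i}
      rw [Finset.card_singleton] at hc
      have := h3 {i}ᶜ (Or.inr (by omega))
      zify at this
      rw [hsplit i]
      linarith
    · obtain ⟨r, hr⟩ := hP
      rw [hff P r (by omega)]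
      have hc := hcomp P
      rcases r with _ | _ | t
      · obtain rfl : P = ∅ := Finset.card_eq_zero.1 hr
        simp
        exact h1
      · have := h3 Pᶜ (Or.inl (by omega))
        zify at this
        push_cast
        linarith
      · have := h4 (t + 1) (by omega) Pᶜ (by push_cast; omega)
        have hc' : ((Pᶜ.card : ℕ) : ℤ) = n - 2 * t - 1 := by omega
        rw [hc'] at this
        push_cast at this ⊢
        linarith

theorem scone_of_incone (n ν d : ℕ) (m : Fin (n + 3) → ℕ)
    (h : InCone (((n : ℤ) + 1) * ((ν * d : ℕ) : ℤ) - ∑ i, ((ν * m i + 1 : ℕ) : ℤ))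
      (fun i => ((ν * d : ℕ) : ℤ) - ((ν * m i + 1 : ℕ) : ℤ))) :
    SCone (((n : ℤ) + 1) * d - ∑ i, (m i : ℤ)) (fun i => (d : ℤ) - m i) := by
  have hν : (0 : ℤ) ≤ ν := by positivity
  have hs : ∑ i, ((ν * m i + 1 : ℕ) : ℤ) = ν * ∑ i, (m i : ℤ) + (n + 3) := by
    push_cast
    rw [Finset.sum_add_distrib, Finset.mul_sum]; simp
  have key : ∀ x : ℤ, 0 < ν * x → 0 < x := fun x hx => pos_of_mul_pos_right hx hν
  obtain ⟨h1, h2⟩ := h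
  have he : ∀ i, 0 < (d : ℤ) - m i := fun i => key _ (by
    have := (h1 i).1
    push_cast at this
    linarith)
  refine ⟨fun i => ⟨he i, ?_⟩, fun P hP => ?_⟩
  · have := (h1 i).2
    rw [hs] at this
    push_cast at this
    have := key ((((n : ℤ) + 1) * d - ∑ i, (m i : ℤ)) - (d - m i)) (by
      have : (0 : ℤ) ≤ n := by positivity
      linarith)
    linarith
  · have h3 := h2 P hP
    obtain ⟨r, hr⟩ := hP
    rw [flip_formula n _ (fun i => ((ν * m i + 1 : ℕ) : ℤ)) P r (by omega)] at h3
    rw [flip_formula n _ (fun i => (m i : ℤ)) P r (by omega)]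
    rw [hs] at h3
    have hs' : ∑ i ∈ Pᶜ, ((ν * m i + 1 : ℕ) : ℤ) = ν * ∑ i ∈ Pᶜ, (m i : ℤ) + (n + 3 - 2 * r) := by
      have : P.card + Pᶜ.card = n + 3 := by
        rw [Finset.card_add_card_compl]; simp
      have h5 : ((Pᶜ.card : ℕ) : ℤ) = n + 3 - 2 * r := by omega
      push_cast
      rw [Finset.sum_add_distrib, Finset.mul_sum]; simp [h5]
    rw [hs'] at h3
    push_cast at h3
    have hd := he 0
    have hm0 : (0 : ℤ) ≤ m 0 := by positivity
    rcases r with _ | r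
    · obtain rfl : P = ∅ := Finset.card_eq_zero.1 hr
      simp
      omega
    · have := key ((((r + 1 : ℕ) : ℤ) * (n - 1) + 1) * d - (((r + 1 : ℕ) : ℤ) - 1) * ∑ i, (m i : ℤ)
        - ∑ i ∈ Pᶜ, (m i : ℤ)) (by
          have h6 : (0 : ℤ) ≤ n := by positivity
          have h7 : (0 : ℤ) ≤ r := by positivity
          push_cast at h3 ⊢
          nlinarith)
      linarith

theorem incone_of_scone (n d : ℕ) (m : Fin (n + 3) → ℕ) (k : ℕ) (hk : (n + 3) * (n + 3) ≤ k)
    (h : SCone (((n : ℤ) + 1) * d - ∑ i, (m i : ℤ)) (fun i => (d : ℤ) - m i)) :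
    1 ≤ k * d ∧ InCone (((n : ℤ) + 1) * ((k * d - 1 : ℕ) : ℤ) - ∑ i, ((k * m i : ℕ) : ℤ))
      (fun i => ((k * d - 1 : ℕ) : ℤ) - ((k * m i : ℕ) : ℤ)) := by
  have hk0 : (((n : ℤ) + 3) * (n + 3)) ≤ k := by exact_mod_cast hk
  have hn0 : (0 : ℤ) ≤ n := by positivity
  have hkn : (n : ℤ) + 3 ≤ k := by nlinarith
  obtain ⟨h1, h2⟩ := h
  have hd : 0 < d := by have := h1 0; dsimp only at this; omega
  have hkd : 1 ≤ k * d := Nat.mul_pos (by omega) hd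
  refine ⟨hkd, ?_⟩
  have hs : ∑ i, ((k * m i : ℕ) : ℤ) = k * ∑ i, (m i : ℤ) := by
    push_cast
    rw [Finset.mul_sum]
  refine ⟨fun i => ⟨?_, ?_⟩, fun P hP => ?_⟩
  · have := (h1 i).1
    push_cast [hkd]
    nlinarith
  · have := (h1 i).2
    rw [hs]
    push_cast [hkd]
    nlinarith
  · have h3 := h2 P hP
    obtain ⟨r, hr⟩ := hP
    have hcard : P.card ≤ n + 3 := by simpa using Finset.card_le_univ P
    rw [flip_formula n _ (fun i => ((k * m i : ℕ) : ℤ)) P r (by omega)]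
    rw [flip_formula n _ (fun i => (m i : ℤ)) P r (by omega)] at h3
    have hs' : ∑ i ∈ Pᶜ, ((k * m i : ℕ) : ℤ) = k * ∑ i ∈ Pᶜ, (m i : ℤ) := by
      push_cast
      rw [Finset.mul_sum]
    rw [hs, hs']
    push_cast [hkd]
    have h4 : (1 : ℤ) ≤ (r * (n - 1) + 1) * d - (r - 1) * ∑ i, (m i : ℤ) - ∑ i ∈ Pᶜ, (m i : ℤ) := by
      linarith
    have h5 := mul_le_mul_of_nonneg_left h4 (show (0 : ℤ) ≤ k by linarith)
    have h6 : (r : ℤ) * (n - 1) + 1 ≤ k := by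
      have : (r : ℤ) ≤ n + 3 := by omega
      have : (0 : ℤ) ≤ r := by positivity
      nlinarith
    linarith

end BigCone

namespace BigCone
open MvPolynomial Finset

/-- the exponent determined by total degree `M` and the tail `γ` -/
noncomputable def expo {q K : ℕ} (M : ℕ) (γ : Fin q → Fin (K + 1)) : Fin (q + 1) →₀ ℕ :=
  Finsupp.equivFunOnFinite.symm (Fin.cons (M - ∑ k, (γ k : ℕ)) (fun k => (γ k : ℕ)))

/-- the conditions for raising all multiplicities by one -/
noncomputable def cond {q s : ℕ} (K : ℕ) (M : Fin s → ℕ) (p : Fin s → Fin (q + 1) → ℂ) :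
    MvPolynomial (Fin (q + 1)) ℂ →ₗ[ℂ] (Fin s × (Fin q → Fin (K + 1)) → ℂ) :=
  LinearMap.pi fun x => (lcoeff ℂ (expo (M x.1) x.2)) ∘ₗ (shift (p x.1)).toLinearMap

lemma raise {q s D K : ℕ} (M : Fin s → ℕ) (hM : ∀ i, M i ≤ K) (p : Fin s → Fin (q + 1) → ℂ)
    (h : s * (K + 1) ^ q < Module.finrank ℂ (Lsys ℂ (q + 1) s D M p)) :
    ∃ f, f ≠ 0 ∧ f ∈ Lsys ℂ (q + 1) s D (fun i => M i + 1) p := by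
  have hfin : Module.Finite ℂ (Lsys ℂ (q + 1) s D M p) := Module.finite_of_finrank_pos (by omega)
  have hker : LinearMap.ker ((cond K M p).domRestrict (Lsys ℂ (q + 1) s D M p)) ≠ ⊥ := by
    apply LinearMap.ker_ne_bot_of_finrank_lt
    simpa using h
  obtain ⟨f, hf, hf0⟩ := Submodule.exists_mem_ne_zero_of_ne_bot hker
  refine ⟨f.1, by simpa using hf0, ?_⟩
  obtain ⟨h1, h2⟩ := (mem_Lsys _ _ _).1 f.2
  refine (mem_Lsys _ _ _).2 ⟨h1, fun i β hβ => ?_⟩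
  rcases Nat.lt_succ_iff_lt_or_eq.1 hβ with hlt | heq
  · exact h2 i β hlt
  · rw [Fin.sum_univ_succ] at heq
    have hle : ∀ k : Fin q, β k.succ ≤ K := fun k => by
      have := Finset.single_le_sum (f := fun k : Fin q => β k.succ) (fun _ _ => Nat.zero_le _)
        (Finset.mem_univ k)
      have := hM i
      omega
    have := congrFun (LinearMap.mem_ker.1 hf) (i, fun k => ⟨β k.succ, Nat.lt_succ_of_le (hle k)⟩)
    have hexp : expo (M i) (fun k => (⟨β k.succ, Nat.lt_succ_of_le (hle k)⟩ : Fin (K + 1))) = β := by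
      ext j
      refine Fin.cases ?_ (fun j => ?_) j
      · simp [expo]; omega
      · simp [expo]
    simp only [cond, LinearMap.domRestrict_apply, LinearMap.pi_apply, LinearMap.comp_apply, hexp] at this
    exact this

lemma mem_Lsys' {n s d : ℕ} (m : Fin s → ℕ) (p : Fin s → Fin n → ℂ) (f : MvPolynomial (Fin n) ℂ) :
    f ∈ Lsys ℂ n s d m p ↔ f.totalDegree ≤ d ∧
      ∀ i, shift (p i) f ∈ idealOfVars (Fin n) ℂ ^ m i := by
  rw [mem_Lsys]
  simp_rw [mem_pow_idealOfVars_iff', Finsupp.degree_eq_sum]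

theorem big_of_incone (n : ℕ) (hn : 0 < n) (d : ℕ) (m : Fin (n + 3) → ℕ) (k : ℕ) (hk : 0 < k)
    (hkd : 1 ≤ k * d) (p : Fin (n + 3) → Fin n → ℂ) (F : MvPolynomial (Fin n) ℂ) (hF0 : F ≠ 0)
    (hF : F ∈ Lsys ℂ n (n + 3) (k * d - 1) (fun i => k * m i) p) (μ : ℕ) :
    (μ + 1) ^ n ≤ Module.finrank ℂ
      (Lsys ℂ n (n + 3) (k * n * μ * d) (fun i => k * n * μ * m i) p) := by
  rw [mem_Lsys'] at hF
  obtain ⟨h1, h2⟩ := hF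
  have hfin : Module.Finite ℂ (Lsys ℂ n (n + 3) (k * n * μ * d) (fun i => k * n * μ * m i) p) :=
    Submodule.finiteDimensional_of_le (S₂ := restrictTotalDegree (Fin n) ℂ (k * n * μ * d))
      inf_le_left
  let ex : (Fin n → Fin (μ + 1)) → (Fin n →₀ ℕ) := fun a =>
    Finsupp.equivFunOnFinite.symm (fun j => (a j : ℕ))
  have hex : Function.Injective ex := by
    intro a b hab
    funext j
    have := DFunLike.congr_fun hab j
    exact Fin.ext (by simpa [ex] using this)
  have hmem : ∀ a, F ^ (n * μ) * monomial (ex a) (1 : ℂ) ∈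
      Lsys ℂ n (n + 3) (k * n * μ * d) (fun i => k * n * μ * m i) p := by
    intro a
    rw [mem_Lsys']
    constructor
    · refine (totalDegree_mul _ _).trans ?_
      have h3 : (F ^ (n * μ)).totalDegree ≤ n * μ * (k * d - 1) :=
        (totalDegree_pow _ _).trans (Nat.mul_le_mul_left _ h1)
      have h4 : (monomial (ex a) (1 : ℂ)).totalDegree ≤ n * μ := by
        refine (totalDegree_monomial_le _ _).trans ?_
        rw [Finsupp.sum_fintype _ _ (by simp)]
        refine (Finset.sum_le_card_nsmul _ _ μ fun j _ => ?_).trans (by simp)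
        simp [ex]; omega
      have h5 : n * μ * (k * d - 1) + n * μ = k * n * μ * d := by
        obtain ⟨w, hw⟩ := Nat.exists_eq_add_of_le hkd
        rw [show k * n * μ * d = n * μ * (k * d) by ring, hw, Nat.add_sub_cancel_left]; ring
      omega
    · intro i
      rw [map_mul, map_pow]
      refine Ideal.mul_mem_right _ _ ?_
      have := Ideal.pow_mem_pow (h2 i) (n * μ)
      rw [← pow_mul] at this
      convert this using 2
      ring
  have hli : LinearIndependent ℂ (fun a : Fin n → Fin (μ + 1) =>
      F ^ (n * μ) * monomial (ex a) (1 : ℂ)) := by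
    have hb : LinearIndependent ℂ (fun a : Fin n → Fin (μ + 1) => monomial (ex a) (1 : ℂ)) := by
      have := (basisMonomials (Fin n) ℂ).linearIndependent.comp ex hex
      simpa [Function.comp_def] using this
    exact hb.map' (LinearMap.mulLeft ℂ (F ^ (n * μ)))
      (LinearMap.ker_eq_bot.2 (mul_right_injective₀ (pow_ne_zero _ hF0)))
  have hli2 : LinearIndependent ℂ (fun a : Fin n → Fin (μ + 1) =>
      (⟨_, hmem a⟩ : Lsys ℂ n (n + 3) (k * n * μ * d) (fun i => k * n * μ * m i) p)) := by
    apply LinearIndependent.of_comp (Submodule.subtype _)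
    exact hli
  have := hli2.fintype_card_le_finrank
  simpa using this

theorem main (n : ℕ) (hn : 2 ≤ n) (d : ℕ) (m : Fin (n + 3) → ℕ) :
    (∃ c : ℝ, 0 < c ∧ ∀ N : ℕ, ∃ ν : ℕ, N ≤ ν ∧
            c * (ν : ℝ) ^ n ≤
              (Module.finrank ℂ ↥(Lsys ℂ n (n + 3) (ν * d) (fun i => ν * m i) (geo n).pt) : ℝ)) ↔
    SCone (((n : ℤ) + 1) * d - ∑ i, (m i : ℤ)) (fun i => (d : ℤ) - m i) := by
  constructor
  · rintro ⟨c, hc, h⟩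
    obtain ⟨q, rfl⟩ : ∃ q, n = q + 1 := ⟨n - 1, by omega⟩
    set μ := ∑ i, m i + 1 with hμ
    obtain ⟨N0, hN0⟩ := exists_nat_gt ((q + 1 + 3) * (2 * μ : ℝ) ^ q / c)
    obtain ⟨ν, hν, hdim⟩ := h (N0 + 1)
    have hν1 : 1 ≤ ν := by omega
    have hlt : (q + 1 + 3) * (ν * μ + 1) ^ q <
        Module.finrank ℂ (Lsys ℂ (q + 1) (q + 1 + 3) (ν * d) (fun i => ν * m i) (geo (q + 1)).pt) := by
      have hνR : (0 : ℝ) < ν := by exact_mod_cast hν1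
      have hN1 : (N0 : ℝ) < ν := by exact_mod_cast hν
      have h1 : (q + 1 + 3) * (2 * μ : ℝ) ^ q < c * ν := by
        have := hN0.trans hN1
        rw [div_lt_iff₀ hc] at this
        linarith
      have h2 : ((ν * μ + 1 : ℕ) : ℝ) ≤ 2 * μ * ν := by
        have : ν * μ + 1 ≤ 2 * μ * ν := by
          have : 1 ≤ ν * μ := Nat.mul_pos hν1 (by omega)
          nlinarith
        exact_mod_cast this
      have h3 : ((ν * μ + 1 : ℕ) : ℝ) ^ q ≤ (2 * μ * ν) ^ q :=
        pow_le_pow_left₀ (by positivity) h2 q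
      have h4 : ((q : ℝ) + 1 + 3) * ((ν * μ + 1 : ℕ) : ℝ) ^ q < c * ν ^ (q + 1) := by
        calc ((q : ℝ) + 1 + 3) * ((ν * μ + 1 : ℕ) : ℝ) ^ q
            ≤ ((q : ℝ) + 1 + 3) * (2 * μ * ν) ^ q := by gcongr
          _ = ((q : ℝ) + 1 + 3) * (2 * μ) ^ q * ν ^ q := by rw [mul_pow]; ring
          _ < c * ν * ν ^ q := by gcongr
          _ = c * ν ^ (q + 1) := by ring
      have h5 := h4.trans_le hdim
      exact_mod_cast h5
    have hex := raise (K := ν * μ) (fun i => ν * m i) (fun i => ?_) _ hlt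
    · have := (lsys_iff (q + 1) (ν * d) (fun i => ν * m i + 1)).1 hex
      exact scone_of_incone (q + 1) ν d m this
    · refine Nat.mul_le_mul_left _ ?_
      have := Finset.single_le_sum (f := m) (fun _ _ => Nat.zero_le _) (Finset.mem_univ i)
      omega
  · intro h
    set k := (n + 3) * (n + 3) with hk
    have hk0 : 0 < k := by positivity
    obtain ⟨hkd, hin⟩ := incone_of_scone n d m k le_rfl h
    obtain ⟨F, hF0, hF⟩ := (lsys_iff n (k * d - 1) (fun i => k * m i)).2 hin
    have hn0 : 0 < n := by omega
    refine ⟨(1 / (k * n : ℝ)) ^ n, by positivity, fun N => ⟨k * n * N, ?_, ?_⟩⟩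
    · exact Nat.le_mul_of_pos_left _ (Nat.mul_pos hk0 hn0)
    · have h1 := big_of_incone n hn0 d m k hk0 hkd _ F hF0 hF N
      have h2 : (1 / (k * n : ℝ)) ^ n * ((k * n * N : ℕ) : ℝ) ^ n = (N : ℝ) ^ n := by
        rw [← mul_pow]
        congr 1
        push_cast
        field_simp
      rw [h2]
      have h3 : N ^ n ≤ (N + 1) ^ n := Nat.pow_le_pow_left (by omega) n
      exact_mod_cast h3.trans h1

end BigCone

/-- The big cone of the blow-up of `ℙⁿ` at `n + 3` points in general position:
`D = dH - Σ mᵢ Eᵢ` is big iff `d > 0`, `mᵢ < d`, `Σ_{i∈I} mᵢ < n·d` for `|I| = n+1, n+2`,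
and `k_{I,σ_t} < 0` for all joins of linear cycles with secant varieties of the rational
normal curve, i.e. `t·Σᵢ mᵢ + Σ_{i∈I} mᵢ < ((n+1)t + |I| - 1)·d` whenever `t ≥ 1` and
`|I| = n - 2t + 1 ≥ 0`. -/
theorem stmt_6 (n : ℕ) (hn : 2 ≤ n) :
    ∃ p : Fin (n + 3) → Fin n → ℂ,
      ∀ (d : ℕ) (m : Fin (n + 3) → ℕ),
        ((∃ c : ℝ, 0 < c ∧ ∀ N : ℕ, ∃ ν : ℕ, N ≤ ν ∧
            c * (ν : ℝ) ^ n ≤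
              (Module.finrank ℂ ↥(Lsys ℂ n (n + 3) (ν * d) (fun i => ν * m i) p) : ℝ)) ↔
          (0 < d ∧ (∀ i, m i < d) ∧
            (∀ I : Finset (Fin (n + 3)), (I.card = n + 1 ∨ I.card = n + 2) →
              (∑ i ∈ I, m i) < n * d) ∧
            (∀ (t : ℕ), 1 ≤ t → ∀ I : Finset (Fin (n + 3)),
              (I.card : ℤ) = (n : ℤ) - 2 * t + 1 →
              (t : ℤ) * (∑ i, (m i : ℤ)) + ∑ i ∈ I, (m i : ℤ) <
                (((n : ℤ) + 1) * t + (I.card : ℤ) - 1) * d))) := by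
  exact ⟨(BigCone.geo n).pt, fun d m =>
    (BigCone.main n hn d m).trans (BigCone.cond_iff n d m)⟩
end
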